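/- arXiv:0912.1068 — 4 statements merged into one kernel-verified Lean document; each statement's English description precedes it below -/
import Mathlib

section
/- Let d be a positive integer and k ∈ ℚ with k ≥ 2. If P ⊂ ℝ^d is a rational polytope of dimension d such that every edge of P has lattice length at least (1/2)·d²·(d+1)·k, then P is k-convex-normal. -/
open Set Metric Pointwise

noncomputable section

/-- Points of the Euclidean space `ℝ^d`. -/
abbrev Pt (d : ℕ) : Type := EuclideanSpace ℝ (Fin d)

/-- `x` is a point of the standard lattice `ℤ^d ⊂ ℝ^d`. -/
def IsLatticePt {d : ℕ} (x : Pt d) : Prop := ∀ i, ∃ n : ℤ, x i = (n : ℝ)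

/-- `x` has rational coordinates. -/
def IsRatPt {d : ℕ} (x : Pt d) : Prop := ∀ i, ∃ q : ℚ, x i = (q : ℝ)

/-- `P` is a polytope with rational vertices. -/
def IsRationalPolytope {d : ℕ} (P : Set (Pt d)) : Prop :=
  ∃ V : Finset (Pt d), (∀ v ∈ V, IsRatPt v) ∧ P = convexHull ℝ (V : Set (Pt d))

/-- `P` is a polytope with integral vertices. -/
def IsLatticePolytope {d : ℕ} (P : Set (Pt d)) : Prop :=
  ∃ V : Finset (Pt d), (∀ v ∈ V, IsLatticePt v) ∧ P = convexHull ℝ (V : Set (Pt d))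

/-- The (affine) dimension of a set. -/
def polyDim {d : ℕ} (P : Set (Pt d)) : ℕ := Module.finrank ℝ (vectorSpan ℝ P)

/-- An integer vector is primitive if its components are coprime. -/
def IsPrimitive {d : ℕ} (u : Fin d → ℤ) : Prop := Finset.univ.gcd u = 1

/-- The segment `[v, w]` has lattice length at least `lb`: whenever `w - v = t • u` with
`u` a primitive integer vector and `t > 0`, one has `t ≥ lb`. -/
def LatLenGE {d : ℕ} (v w : Pt d) (lb : ℝ) : Prop :=
  ∀ (u : Fin d → ℤ) (t : ℝ), 0 < t → IsPrimitive u →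
    (∀ i, w i - v i = t * (u i : ℝ)) → lb ≤ t

/-- The segment `[v, w]` has lattice length greater than `lb`. -/
def LatLenGT {d : ℕ} (v w : Pt d) (lb : ℝ) : Prop :=
  ∀ (u : Fin d → ℤ) (t : ℝ), 0 < t → IsPrimitive u →
    (∀ i, w i - v i = t * (u i : ℝ)) → lb < t

/-- `[v, w]` is an edge (a one-dimensional face) of `P`. -/
def IsEdge {d : ℕ} (P : Set (Pt d)) (v w : Pt d) : Prop :=
  v ≠ w ∧ IsExtreme ℝ P (segment ℝ v w)

/-- Every edge of `P` has lattice length at least `lb`. -/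
def EdgeLengthsGE {d : ℕ} (P : Set (Pt d)) (lb : ℝ) : Prop :=
  ∀ v w, IsEdge P v w → LatLenGE v w lb

/-- Every edge of `P` has lattice length greater than `lb`. -/
def EdgeLengthsGT {d : ℕ} (P : Set (Pt d)) (lb : ℝ) : Prop :=
  ∀ v w, IsEdge P v w → LatLenGT v w lb

/-- The union `⋃ (x + P)` over all vertices `v` of `P` and all
`x ∈ (c-1)P ∩ ((c-1)v + ℤ^d)`. -/
def cnUnion {d : ℕ} (P : Set (Pt d)) (c : ℝ) : Set (Pt d) :=
  {y | ∃ v ∈ Set.extremePoints ℝ P, ∃ x ∈ (c - 1) • P,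
    IsLatticePt (x - (c - 1) • v) ∧ ∃ p ∈ P, y = x + p}

/-- `P` is `k`-convex-normal: `CN(d,k)`. -/
def ConvexNormal {d : ℕ} (k : ℚ) (P : Set (Pt d)) : Prop :=
  ∀ c : ℚ, 2 ≤ c → c ≤ k → (c : ℝ) • P = cnUnion P (c : ℝ)

/-- `P` is integrally closed. -/
def IntegrallyClosed {d : ℕ} (P : Set (Pt d)) : Prop :=
  ∀ c : ℕ, 0 < c → ∀ z ∈ (c : ℝ) • P, IsLatticePt z →
    ∃ x : Fin c → Pt d, (∀ i, x i ∈ P ∧ IsLatticePt (x i)) ∧ ∑ i, x i = z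

/-- A face of a polytope: a closed convex extreme subset. -/
def IsFaceOf {d : ℕ} (P F : Set (Pt d)) : Prop :=
  IsExtreme ℝ P F ∧ Convex ℝ F ∧ IsClosed F

/-- A facet: a face of codimension one. -/
def IsFacetOf {d : ℕ} (P F : Set (Pt d)) : Prop :=
  IsFaceOf P F ∧ polyDim F + 1 = polyDim P

/-- `width_F(P)`: the maximum over vertices `v` of `P` of `dist(v, aff F)`. -/
def facetWidth {d : ℕ} (P F : Set (Pt d)) : ℝ :=
  sSup ((fun v => infDist v ((affineSpan ℝ F : AffineSubspace ℝ (Pt d)) : Set (Pt d))) ''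
    Set.extremePoints ℝ P)

/-- `U_P(F, ε)`: the `ε`-layer of `P` along (the affine hull of) `F`. -/
def layer {d : ℕ} (P F : Set (Pt d)) (ε : ℝ) : Set (Pt d) :=
  {x ∈ P | infDist x ((affineSpan ℝ F : AffineSubspace ℝ (Pt d)) : Set (Pt d)) ≤ ε}

/-- `P` is `k`-boundary-convex-normal: `BCN(d,k)`. -/
def BCN {d : ℕ} (k : ℚ) (P : Set (Pt d)) : Prop :=
  ∀ F, IsFacetOf P F → ∀ c : ℚ, 2 ≤ c → c ≤ k →
    layer ((c : ℝ) • P) ((c : ℝ) • F) (facetWidth P F / ((d : ℝ) + 1)) ⊆ cnUnion P (c : ℝ)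

/-- The parallelepiped `z + {Σ λᵢ • wᵢ : 0 ≤ λᵢ ≤ 1}`. -/
def Parallelepiped {d m : ℕ} (z : Pt d) (w : Fin m → Pt d) : Set (Pt d) :=
  {x | ∃ lam : Fin m → ℝ, (∀ i, lam i ∈ Icc (0 : ℝ) 1) ∧ x = z + ∑ i, lam i • w i}

/-- `L` is a full-dimensional lattice parallelepiped. -/
def IsLatticeParallelepiped {d : ℕ} (L : Set (Pt d)) : Prop :=
  ∃ (z : Pt d) (w : Fin d → Pt d), IsLatticePt z ∧ (∀ i, IsLatticePt (w i)) ∧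
    LinearIndependent ℝ w ∧ L = Parallelepiped z w

section Aux
variable {d : ℕ}

lemma aux_hull {P : Set (Pt d)} (hc : IsCompact P) (hv : Convex ℝ P)
    (hf : (P.extremePoints ℝ).Finite) : convexHull ℝ (P.extremePoints ℝ) = P := by
  have := closure_convexHull_extremePoints hc hv
  rwa [(hf.isClosed_convexHull ℝ).closure_eq] at this

lemma aux_edge_span {P : Set (Pt d)} (hc : IsCompact P) (hv : Convex ℝ P)
    (hf : (P.extremePoints ℝ).Finite) {v : Pt d} (hvE : v ∈ P.extremePoints ℝ) :
    ∀ p ∈ P, p - v ∈ Submodule.span ℝ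
      {e : Pt d | ∃ w ∈ P.extremePoints ℝ, IsEdge P v w ∧ e = w - v} := by
  set E := P.extremePoints ℝ with hE
  set S := {e : Pt d | ∃ w ∈ E, IsEdge P v w ∧ e = w - v} with hS
  have hhull : convexHull ℝ E = P := aux_hull hc hv hf
  have hvP : v ∈ P := hvE.1
  -- separating functional
  have hvn : v ∉ convexHull ℝ (E \ {v}) := by
    have h1 := (hv.mem_extremePoints_iff_mem_sdiff_convexHull_sdiff).1 hvE
    intro h
    exact h1.2 (convexHull_mono (sdiff_subset_sdiff_left extremePoints_subset) h)
  obtain ⟨h, u, hu1, hu2⟩ := geometric_hahn_banach_point_closed (convex_convexHull ℝ (E \ {v}))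
    ((hf.subset sdiff_subset).isClosed_convexHull ℝ) hvn
  have hpos : ∀ w ∈ E, w ≠ v → 0 < h (w - v) := by
    intro w hw hne
    have := hu2 w (subset_convexHull ℝ _ ⟨hw, hne⟩)
    rw [map_sub]; linarith
  let ρ : Pt d → Pt d := fun w => (h (w - v))⁻¹ • (w - v)
  set T := ρ '' (E \ {v}) with hT
  have hTf : T.Finite := (hf.subset sdiff_subset).image _
  set R := convexHull ℝ T with hR
  have hRc : IsCompact R := hTf.isCompact_convexHull ℝ
  have hRv : Convex ℝ R := convex_convexHull ℝ T
  have hR1 : ∀ r ∈ R, h r = 1 := by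
    intro r hr
    have hsub : R ⊆ {r | h r = 1} := by
      apply convexHull_min
      · rintro _ ⟨w, ⟨hw, hne⟩, rfl⟩
        have := hpos w hw hne
        simp only [ρ, mem_ofPred_eq, map_smul, smul_eq_mul]
        field_simp
      · exact convex_hyperplane h.toLinearMap.isLinear 1
    exact hsub hr
  -- representation
  have hrep : ∀ p ∈ P, p = v ∨ ∃ s : ℝ, 0 < s ∧ ∃ r ∈ R, p - v = s • r := by
    have hsub : P ⊆ {p | p = v ∨ ∃ s : ℝ, 0 < s ∧ ∃ r ∈ R, p - v = s • r} := by
      rw [← hhull]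
      apply convexHull_min
      · intro w hw
        by_cases hne : w = v
        · exact Or.inl hne
        · have := hpos w hw hne
          refine Or.inr ⟨h (w - v), this, ρ w, subset_convexHull ℝ _ ⟨w, ⟨hw, hne⟩, rfl⟩, ?_⟩
          simp only [ρ]
          rw [smul_smul, mul_inv_cancel₀ this.ne', one_smul]
      · intro p1 hp1 p2 hp2 α β hα hβ hαβ
        rcases eq_or_lt_of_le hα with h0 | hα
        · have : β = 1 := by linarith
          subst h0; subst this; simpa using hp2
        rcases eq_or_lt_of_le hβ with h0 | hβ
        · have : α = 1 := by linarith
          subst h0; subst this; simpa using hp1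
        have key : α • p1 + β • p2 - v = α • (p1 - v) + β • (p2 - v) := by
          have : v = (α + β) • v := by rw [hαβ, one_smul]
          nth_rewrite 1 [this]
          module
        rcases hp1 with hp1 | ⟨s1, hs1, r1, hr1, e1⟩ <;> rcases hp2 with hp2 | ⟨s2, hs2, r2, hr2, e2⟩
        · left
          rw [hp1, hp2, ← add_smul, hαβ, one_smul]
        · right
          refine ⟨β * s2, by positivity, r2, hr2, ?_⟩
          rw [key, hp1, e2]; module
        · right
          refine ⟨α * s1, by positivity, r1, hr1, ?_⟩
          rw [key, hp2, e1]; module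
        · right
          have hs : 0 < α * s1 + β * s2 := by positivity
          refine ⟨α * s1 + β * s2, hs, (α * s1 / (α * s1 + β * s2)) • r1 + (β * s2 / (α * s1 + β * s2)) • r2,
            hRv hr1 hr2 (by positivity) (by positivity) (by field_simp), ?_⟩
          rw [key, e1, e2, smul_add, smul_smul, smul_smul, smul_smul, smul_smul,
            mul_div_cancel₀ _ hs.ne', mul_div_cancel₀ _ hs.ne']
    exact hsub
  -- extreme rays give edges
  have hext : R.extremePoints ℝ ⊆ (Submodule.span ℝ S : Set (Pt d)) := by
    intro r hr
    have hrT : r ∈ T := extremePoints_convexHull_subset hr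
    obtain ⟨w, ⟨hw, hne⟩, hwr⟩ := hrT
    have hne : w ≠ v := hne
    have hσ := hpos w hw hne
    set σ := h (w - v) with hσd
    have hwσ : w - v = σ • r := by
      rw [← hwr]; simp only [ρ]
      rw [smul_smul, mul_inv_cancel₀ hσ.ne', one_smul]
    have hedge : IsEdge P v w := by
      refine ⟨hne.symm, hv.segment_subset hvP hw.1, ?_⟩
      -- points of P on the ray are in the segment
      have hray : ∀ p ∈ P, ∀ s : ℝ, 0 ≤ s → p - v = s • r → p ∈ segment ℝ v w := by
        intro p hp s hs hps
        have hsσ : s ≤ σ := by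
          by_contra hlt
          push Not at hlt
          have hs0 : 0 < s := hσ.trans hlt
          have : w ∈ openSegment ℝ v p := by
            refine ⟨1 - σ / s, σ / s, by rw [sub_pos, div_lt_one hs0]; exact hlt, by positivity, by ring, ?_⟩
            have e1 : p = v + s • r := by rw [← hps]; abel
            have e2 : w = v + σ • r := by rw [← hwσ]; abel
            rw [e1, e2, smul_add, smul_smul, div_mul_cancel₀ _ hs0.ne']
            module
          exact hne (hw.2 hvP hp this).symm
        refine ⟨1 - s / σ, s / σ, by rw [sub_nonneg, div_le_one hσ]; exact hsσ, by positivity, by ring, ?_⟩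
        have e1 : p = v + s • r := by rw [← hps]; abel
        have e2 : w = v + σ • r := by rw [← hwσ]; abel
        rw [e1, e2, smul_add, smul_smul, div_mul_cancel₀ _ hσ.ne']
        module
      intro p1 hp1 p2 hp2 x hx hxo
      obtain ⟨α, β, hα, hβ, hαβ, rfl⟩ := hxo
      obtain ⟨a', t, ha', ht, hat, hxe⟩ := hx
      have key : α • (p1 - v) + β • (p2 - v) = (t * σ) • r := by
        have e2 : w = v + σ • r := by rw [← hwσ]; abel
        have e3 : α • (p1 - v) + β • (p2 - v) = (α • p1 + β • p2) - (α + β) • v := by module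
        have e4 : a' = 1 - t := by linarith
        rw [e3, ← hxe, hαβ, e2, e4]; module
      have hr1 : h r = 1 := hR1 r hr.1
      rcases hrep p1 hp1 with h1 | ⟨s1, hs1, r1, hr1R, e1⟩
      · rw [h1]; exact left_mem_segment ℝ v w
      rcases hrep p2 hp2 with h2 | ⟨s2, hs2, r2, hr2R, e2⟩
      · apply hray p1 hp1 (α⁻¹ * (t * σ)) (by positivity)
        rw [h2, sub_self, smul_zero, add_zero] at key
        rw [mul_smul, ← key, smul_smul, inv_mul_cancel₀ hα.ne', one_smul]
      · rw [e1, e2] at key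
        have hk := congrArg h key
        simp only [map_add, map_smul, smul_eq_mul, hr1, hR1 r1 hr1R, hR1 r2 hr2R, mul_one] at hk
        have hs : 0 < α * s1 + β * s2 := by positivity
        have : r ∈ openSegment ℝ r1 r2 := by
          refine ⟨α * s1 / (α * s1 + β * s2), β * s2 / (α * s1 + β * s2), by positivity, by positivity,
            by field_simp, ?_⟩
          have : r = (α * s1 + β * s2)⁻¹ • ((t * σ) • r) := by
            rw [← hk, smul_smul, inv_mul_cancel₀ hs.ne', one_smul]
          rw [this, ← key]
          simp only [smul_add, smul_smul]
          congr 2 <;> field_simp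
        have := hr.2 hr1R hr2R this
        rw [this] at e1
        exact hray p1 hp1 s1 hs1.le e1
    have : r = σ⁻¹ • (w - v) := by rw [hwσ, smul_smul, inv_mul_cancel₀ hσ.ne', one_smul]
    rw [this]
    exact Submodule.smul_mem _ _ (Submodule.subset_span ⟨w, hw, hedge, rfl⟩)
  have hRs : R ⊆ (Submodule.span ℝ S : Set (Pt d)) := by
    rw [← closure_convexHull_extremePoints hRc hRv]
    exact closure_minimal (convexHull_min hext (Submodule.convex _))
      (Submodule.closed_of_finiteDimensional _)
  intro p hp
  rcases hrep p hp with h1 | ⟨s, hs, r, hr, e⟩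
  · rw [h1, sub_self]; exact Submodule.zero_mem _
  · rw [e]; exact Submodule.smul_mem _ _ (hRs hr)

/-- directions in which one can move both ways from `q`. -/
def auxD (P : Set (Pt d)) (hP : Convex ℝ P) (q : Pt d) (hq : q ∈ P) : Submodule ℝ (Pt d) where
  carrier := {e | ∃ τ : ℝ, 0 < τ ∧ q + τ • e ∈ P ∧ q - τ • e ∈ P}
  zero_mem' := ⟨1, one_pos, by simpa using hq, by simpa using hq⟩
  add_mem' := by
    rintro e f ⟨τ, hτ, h1, h2⟩ ⟨τ', hτ', h3, h4⟩
    have hs : 0 < τ + τ' := by positivity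
    have hsum : τ' / (τ + τ') + τ / (τ + τ') = 1 := by field_simp; ring
    have hq' : q = (τ' / (τ + τ') + τ / (τ + τ')) • q := by rw [hsum, one_smul]
    have k : τ' / (τ + τ') * τ = τ * τ' / (τ + τ') := by ring
    have k' : τ / (τ + τ') * τ' = τ * τ' / (τ + τ') := by ring
    refine ⟨τ * τ' / (τ + τ'), by positivity, ?_, ?_⟩
    · have := hP h1 h3 (a := τ' / (τ + τ')) (b := τ / (τ + τ')) (by positivity) (by positivity) hsum
      convert this using 1
      nth_rewrite 1 [hq']
      simp only [smul_add, smul_smul, k, k', add_smul]; abel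
    · have := hP h2 h4 (a := τ' / (τ + τ')) (b := τ / (τ + τ')) (by positivity) (by positivity) hsum
      convert this using 1
      nth_rewrite 1 [hq']
      simp only [smul_add, smul_sub, smul_smul, k, k', add_smul]; abel
  smul_mem' := by
    rintro a e ⟨τ, hτ, h1, h2⟩
    rcases lt_trichotomy a 0 with ha | ha | ha
    · refine ⟨τ / (-a), div_pos hτ (by linarith), ?_, ?_⟩
      · convert h2 using 1
        rw [smul_smul, show τ / -a * a = -τ by have ha2 := ha.ne; field_simp]; module
      · convert h1 using 1
        rw [smul_smul, show τ / -a * a = -τ by have ha2 := ha.ne; field_simp]; module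
    · exact ⟨1, one_pos, by simpa [ha] using hq, by simpa [ha] using hq⟩
    · refine ⟨τ / a, by positivity, ?_, ?_⟩
      · convert h1 using 1
        rw [smul_smul, div_mul_cancel₀ _ ha.ne']
      · convert h2 using 1
        rw [smul_smul, div_mul_cancel₀ _ ha.ne']

lemma aux_face_extreme {P : Set (Pt d)} (hP : Convex ℝ P) {q : Pt d} (hq : q ∈ P) :
    IsExtreme ℝ P {p | p ∈ P ∧ p - q ∈ auxD P hP q hq} := by
  refine ⟨fun p hp => hp.1, ?_⟩
  intro p1 hp1 p2 hp2 x hx hxo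
  obtain ⟨α, β, hα, hβ, hαβ, rfl⟩ := hxo
  obtain ⟨-, τ, hτ, -, h2⟩ := hx
  refine ⟨hp1, ?_⟩
  have hs : 0 < 1 + τ * β := by positivity
  set κ := τ * α / (1 + τ * β) with hκ
  have hκ0 : 0 < κ := by positivity
  have hm : q - κ • (p1 - q) ∈ P := by
    have := hP h2 hp2 (a := 1 / (1 + τ * β)) (b := τ * β / (1 + τ * β)) (by positivity) (by positivity)
      (by field_simp)
    convert this using 1
    have hα' : α = 1 - β := by linarith
    have hq' : q = (1 / (1 + τ * β) + τ * β / (1 + τ * β)) • q := by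
      rw [show 1 / (1 + τ * β) + τ * β / (1 + τ * β) = 1 by field_simp, one_smul]
    have : (1 / (1 + τ * β)) • (q - τ • (α • p1 + β • p2 - q)) + (τ * β / (1 + τ * β)) • p2
       = (1 / (1 + τ * β) + τ * β / (1 + τ * β)) • q - κ • (p1 - q) := by
      rw [hκ, hα']
      match_scalars <;> field_simp <;> ring
    rw [this, ← hq']
  -- a common τ
  refine ⟨min κ 1, by positivity, ?_, ?_⟩
  · exact hP.add_smul_sub_mem hq hp1 ⟨by positivity, min_le_right _ _⟩
  · have := hP.add_smul_sub_mem hq hm (t := min κ 1 / κ) ⟨by positivity, by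
      rw [div_le_one hκ0]; exact min_le_left _ _⟩
    convert this using 1
    rw [sub_sub_cancel_left, smul_neg, smul_smul, div_mul_cancel₀ _ hκ0.ne', sub_eq_add_neg]

lemma aux_move {P : Set (Pt d)} (hv : Convex ℝ P) {y p p' q : Pt d} {η l : ℝ} (hη : 0 < η)
    (hη1 : η < 1) (hy : y ∈ P) (hp' : p' ∈ P) (hq : q ∈ P)
    (h : y = η • p + (1 - η) • q) (hl : 0 ≤ l) (hlη : l ≤ η) : y + l • (p' - p) ∈ P := by
  have h1 : y + η • (p' - p) ∈ P := by
    have := hv hp' hq hη.le (b := 1 - η) (by linarith) (by ring)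
    convert this using 1
    rw [h]; module
  have := hv.add_smul_mem hy h1 (t := l / η) ⟨by positivity, by rw [div_le_one hη]; exact hlη⟩
  rwa [smul_smul, div_mul_cancel₀ _ hη.ne'] at this

lemma aux_sum {P : Set (Pt d)} (hv : Convex ℝ P) {y : Pt d} (hy : y ∈ P) (s : Finset (Pt d))
    (μ : Pt d → ℝ) (η : ℝ) (hμ : ∀ e ∈ s, |μ e| * s.card ≤ η)
    (hm : ∀ e ∈ s, ∀ l : ℝ, |l| ≤ η → y + l • e ∈ P) : y + ∑ e ∈ s, μ e • e ∈ P := by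
  rcases s.eq_empty_or_nonempty with rfl | hs
  · simpa using hy
  have hN : (0 : ℝ) < s.card := by exact_mod_cast hs.card_pos
  have := hv.sum_mem (t := s) (w := fun _ => (s.card : ℝ)⁻¹)
    (z := fun e => y + (s.card * μ e) • e) (fun _ _ => by positivity) (by
      rw [Finset.sum_const, nsmul_eq_mul, mul_inv_cancel₀ hN.ne'])
    (fun e he => hm e he _ (by rw [abs_mul, abs_of_pos hN, mul_comm]; exact hμ e he))
  convert this using 1
  simp only [smul_add, Finset.sum_add_distrib, smul_smul, ← mul_assoc, inv_mul_cancel₀ hN.ne', one_mul]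
  rw [Finset.sum_const, ← Nat.cast_smul_eq_nsmul ℝ, smul_smul, mul_inv_cancel₀ hN.ne', one_smul]

lemma aux_lattice_sum (s : Finset (Pt d)) (n : Pt d → ℤ) (u : Pt d → Pt d)
    (hu : ∀ e ∈ s, IsLatticePt (u e)) : IsLatticePt (∑ e ∈ s, (n e : ℝ) • u e) := by
  classical
  induction s using Finset.induction_on with
  | empty => intro i; exact ⟨0, by simp⟩
  | insert e s he ih =>
    intro i
    rw [Finset.sum_insert he]
    obtain ⟨k1, h1⟩ := hu e (Finset.mem_insert_self e s) i
    obtain ⟨k2, h2⟩ := ih (fun e' he' => hu e' (Finset.mem_insert_of_mem he')) i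
    refine ⟨n e * k1 + k2, ?_⟩
    rw [PiLp.add_apply, PiLp.smul_apply, h1, h2]
    push_cast
    simp

lemma aux_num {m A B : ℝ} (hm : 0 ≤ m) (hA : 0 ≤ A) (hB : 0 ≤ B) (hAB : A ≤ B) :
    1 / 2 * m ^ 2 * (m + 1) * A ≤
      ((m + 1) / (m + 2)) ^ 2 * (1 / 2 * (m + 1) ^ 2 * (m + 1 + 1) * B) := by
  have h5 : ((m + 1) / (m + 2)) ^ 2 * (1 / 2 * (m + 1) ^ 2 * (m + 1 + 1) * B)
      = (1 / 2 * (m + 1) ^ 4 / (m + 2)) * B := by field_simp; ring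
  rw [h5]
  refine mul_le_mul ?_ hAB hA (by positivity)
  rw [le_div_iff₀ (by positivity)]
  have h1 : 0 ≤ m ^ 3 := by positivity
  have h2 : 0 ≤ m ^ 2 := by positivity
  nlinarith

set_option maxHeartbeats 1000000 in
theorem aux_main (m : ℕ) : ∀ (P : Set (Pt d)), IsCompact P → Convex ℝ P →
    (P.extremePoints ℝ).Finite → Module.finrank ℝ (vectorSpan ℝ P) ≤ m →
    ∀ a b L : ℝ, 0 < b → b ≤ a → (1 / 2 : ℝ) * (m : ℝ) ^ 2 * ((m : ℝ) + 1) * (a + b) ≤ b ^ 2 * L →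
    (∀ v ∈ P.extremePoints ℝ, ∀ w ∈ P.extremePoints ℝ, IsEdge P v w →
      ∃ t : ℝ, L ≤ t ∧ ∃ u : Pt d, IsLatticePt u ∧ w - v = t • u) →
    ∀ y ∈ P, ∃ v ∈ P.extremePoints ℝ, ∃ p1 ∈ P, ∃ p2 ∈ P,
      IsLatticePt (a • p1 - a • v) ∧ (a + b) • y = a • p1 + b • p2 := by
  induction m with
  | zero =>
    intro P hc hv hf hr a b L hb hba hL hg y hy
    have h0 : vectorSpan ℝ P = ⊥ := Submodule.finrank_eq_zero.1 (by omega)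
    have hsub : ∀ x ∈ P, x = y := by
      intro x hx
      have := vsub_mem_vectorSpan ℝ hx hy
      rw [h0, Submodule.mem_bot, vsub_eq_sub, sub_eq_zero] at this
      exact this
    refine ⟨y, ⟨hy, fun x1 hx1 x2 hx2 _ => hsub x1 hx1⟩, y, hy, y, hy, ?_, by module⟩
    intro i; exact ⟨0, by simp⟩
  | succ m ih =>
    intro P hc hv hf hr a b L hb hba hL hg y hy
    push_cast at hL
    have hm0 : (0 : ℝ) ≤ m := Nat.cast_nonneg m
    have ha : 0 < a := hb.trans_le hba
    set η : ℝ := b / ((a + b) * (m + 2)) with hη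
    have hη0 : 0 < η := by positivity
    have hη1 : η < 1 := by
      rw [hη, div_lt_one (by positivity)]; nlinarith
    have hηe : (a + b) * η = b / (m + 2) := by rw [hη]; field_simp
    by_cases hB : ∀ v ∈ P.extremePoints ℝ, ∃ q ∈ P, y = η • v + (1 - η) • q
    · -- deep points
      have hLpos : 0 < L := by
        by_contra h
        push Not at h
        have h1 : b ^ 2 * L ≤ 0 := mul_nonpos_of_nonneg_of_nonpos (by positivity) h
        have h2 : 0 < 1 / 2 * ((m : ℝ) + 1) ^ 2 * (m + 1 + 1) * (a + b) := by positivity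
        linarith
      obtain ⟨v, hvE⟩ := hc.extremePoints_nonempty ⟨y, hy⟩
      set S := {e : Pt d | ∃ w ∈ P.extremePoints ℝ, IsEdge P v w ∧ e = w - v} with hS
      have hspan := aux_edge_span hc hv hf hvE
      have hyS : a • (y - v) ∈ Submodule.span ℝ S := Submodule.smul_mem _ _ (hspan y hy)
      obtain ⟨r, hcard, hsup, hsum⟩ := Submodule.mem_span_set_iff_exists_finsupp_le_finrank.1 hyS
      have hcard2 : r.support.card ≤ m + 1 := by
        refine hcard.trans (le_trans (Submodule.finrank_mono ?_) hr)
        rw [Submodule.span_le]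
        rintro _ ⟨w, hw, -, rfl⟩
        exact vsub_mem_vectorSpan ℝ hw.1 hvE.1
      have hch : ∀ e : Pt d, ∃ t : ℝ, ∃ u : Pt d, e ∈ S → L ≤ t ∧ IsLatticePt u ∧ e = t • u := by
        intro e
        by_cases he : e ∈ S
        · obtain ⟨w, hw, hed, rfl⟩ := he
          obtain ⟨t, ht, u, hu, h⟩ := hg v hvE w hw hed
          exact ⟨t, u, fun _ => ⟨ht, hu, h⟩⟩
        · exact ⟨0, 0, fun h => absurd h he⟩
      choose t u htu using hch
      have hin : ∀ e ∈ r.support, e ∈ S := fun e he => hsup he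
      let κ : Pt d → ℝ := fun e => ((round (r e * t e) : ℤ) - r e * t e) / t e
      have hκ : ∀ e ∈ r.support, |κ e| ≤ 1 / (2 * L) := by
        intro e he
        have h1 := (htu e (hin e he)).1
        have h2 : 0 < t e := hLpos.trans_le h1
        simp only [κ]
        rw [abs_div, abs_of_pos h2, abs_sub_comm]
        calc |r e * t e - (round (r e * t e) : ℤ)| / t e ≤ (1 / 2) / L := by
              gcongr
              exact abs_sub_round _
          _ = 1 / (2 * L) := by field_simp
      set δ := ∑ e ∈ r.support, κ e • e with hδ
      have hmove : ∀ e ∈ r.support, ∀ l : ℝ, |l| ≤ η → y + l • e ∈ P := by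
        intro e he l hl
        obtain ⟨w, hw, hed, rfl⟩ := hin e he
        obtain ⟨q1, hq1, h1⟩ := hB v hvE
        obtain ⟨q2, hq2, h2⟩ := hB w hw
        rcases le_total 0 l with h0 | h0
        · rw [abs_of_nonneg h0] at hl
          exact aux_move hv hη0 hη1 hy hw.1 hq1 h1 h0 hl
        · rw [abs_of_nonpos h0] at hl
          have := aux_move hv hη0 hη1 hy hvE.1 hq2 h2 (neg_nonneg.2 h0) hl
          convert this using 2
          module
      have hbound : 1 / (2 * L) / b * (m + 1) ≤ η := by
        rw [hη, div_div, div_mul_eq_mul_div, div_le_div_iff₀ (by positivity) (by positivity)]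
        have h1 : (m + 1 : ℝ) * ((a + b) * (m + 2)) ≤ (m + 1) ^ 2 * (m + 2) * (a + b) := by
          have : 0 ≤ (m : ℝ) * (m + 1) * (m + 2) * (a + b) := by positivity
          nlinarith
        nlinarith
      have hgen : ∀ σ : ℝ, |σ| ≤ 1 / b → y + σ • δ ∈ P := by
        intro σ hσ
        have := aux_sum hv hy r.support (fun e => σ * κ e) η (by
          intro e he
          refine le_trans ?_ hbound
          rw [abs_mul]
          have h1 : |σ| * |κ e| ≤ (1 / b) * (1 / (2 * L)) :=
            mul_le_mul hσ (hκ e he) (abs_nonneg _) (by positivity)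
          have h2 : (r.support.card : ℝ) ≤ m + 1 := by exact_mod_cast hcard2
          calc |σ| * |κ e| * r.support.card ≤ ((1 / b) * (1 / (2 * L))) * (m + 1) :=
                mul_le_mul h1 h2 (Nat.cast_nonneg _) (by positivity)
            _ = _ := by ring) hmove
        convert this using 2
        rw [hδ, Finset.smul_sum]
        exact Finset.sum_congr rfl fun e _ => smul_smul _ _ _
      refine ⟨v, hvE, y + (1 / a) • δ, hgen _ ?_, y + (-(1 / b)) • δ, hgen _ ?_, ?_, ?_⟩
      · rw [abs_of_pos (by positivity)]
        exact one_div_le_one_div_of_le hb hba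
      · rw [abs_neg, abs_of_pos (by positivity)]
      · have e1 : a • (y + (1 / a) • δ) - a • v = a • (y - v) + δ := by
          rw [smul_add, smul_smul, mul_one_div_cancel ha.ne']; module
        have e2 : a • (y - v) + δ = ∑ e ∈ r.support, ((round (r e * t e) : ℤ) : ℝ) • u e := by
          rw [← hsum, hδ, Finsupp.sum, ← Finset.sum_add_distrib]
          refine Finset.sum_congr rfl fun e he => ?_
          obtain ⟨h1, h2, h3⟩ := htu e (hin e he)
          have h4 : 0 < t e := hLpos.trans_le h1
          rw [← add_smul]
          nth_rewrite 3 [h3]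
          rw [smul_smul]
          congr 1
          simp only [κ]
          field_simp
          ring
        rw [e1, e2]
        exact aux_lattice_sum _ _ _ fun e he => (htu e (hin e he)).2.1
      · rw [smul_add, smul_add, smul_smul, smul_smul, mul_one_div_cancel ha.ne', mul_neg,
          mul_one_div_cancel hb.ne']
        module
    · push Not at hB
      obtain ⟨v, hvE, hvn⟩ := hB
      have hyv : y ≠ v := by
        rintro rfl
        exact hvn y hy (by module)
      -- the last point on the ray
      obtain ⟨s, hs, hsmax⟩ : ∃ s ∈ {s : ℝ | v + s • (y - v) ∈ P},
          ∀ s' ∈ {s : ℝ | v + s • (y - v) ∈ P}, s' ≤ s := by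
        have hcl : IsClosed {s : ℝ | v + s • (y - v) ∈ P} :=
          hc.isClosed.preimage (f := fun s : ℝ => v + s • (y - v)) (by fun_prop)
        have hbd : BddAbove {s : ℝ | v + s • (y - v) ∈ P} := by
          obtain ⟨C, hC⟩ := hc.isBounded.exists_norm_le
          have hn : 0 < ‖y - v‖ := norm_pos_iff.2 (sub_ne_zero.2 hyv)
          refine ⟨(C + ‖v‖) / ‖y - v‖, fun s hs => ?_⟩
          rw [le_div_iff₀ hn]
          have h1 := hC _ hs
          have h2 : ‖s • (y - v)‖ ≤ ‖v + s • (y - v)‖ + ‖v‖ := by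
            have := norm_sub_le (v + s • (y - v)) v
            rwa [add_sub_cancel_left] at this
          rw [norm_smul, Real.norm_eq_abs] at h2
          have h3 := mul_le_mul_of_nonneg_right (le_abs_self s) hn.le
          linarith
        have hne : {s : ℝ | v + s • (y - v) ∈ P}.Nonempty := ⟨1, by simpa using hy⟩
        exact ⟨_, hcl.csSup_mem hne hbd, fun s' hs' => le_csSup hbd hs'⟩
      have hs1 : 1 ≤ s := hsmax 1 (by simpa using hy)
      have hs0 : 0 < s := by linarith
      have hsP : v + s • (y - v) ∈ P := hs
      set q := v + s • (y - v) with hq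
      set ε := 1 - 1 / s with hε
      have hε0 : 0 ≤ ε := by
        rw [hε, sub_nonneg, div_le_one hs0]; exact hs1
      have hyε : y = ε • v + (1 - ε) • q := by
        rw [hq, hε, sub_sub_cancel, smul_add, smul_smul, one_div_mul_cancel hs0.ne']; module
      have hεη : ε < η := by
        by_contra hle
        push Not at hle
        have h1 : 1 / (1 - η) ≤ s := by
          rw [div_le_iff₀ (by linarith)]
          have : 1 / s ≤ 1 - η := by rw [hε] at hle; linarith
          rw [div_le_iff₀ hs0] at this
          linarith
        have h2 : v + (1 / (1 - η)) • (y - v) ∈ P := by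
          have h3 := hv.add_smul_mem hvE.1 hsP (t := (1 / (1 - η)) / s)
            ⟨by have : 0 < 1 - η := by linarith
                positivity, by rw [div_le_one hs0]; exact h1⟩
          rwa [smul_smul, div_mul_cancel₀ _ hs0.ne'] at h3
        refine hvn _ h2 ?_
        rw [smul_add, smul_smul, mul_one_div_cancel (by linarith : (1 - η) ≠ 0)]
        module
      set D := auxD P hv q hsP with hD
      set F := {p | p ∈ P ∧ p - q ∈ D} with hF
      have hFe : IsExtreme ℝ P F := aux_face_extreme hv hsP
      have hqF : q ∈ F := ⟨hsP, by rw [sub_self]; exact D.zero_mem⟩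
      have hFv : Convex ℝ F := by
        intro p1 h1 p2 h2 α β hα hβ hαβ
        refine ⟨hv h1.1 h2.1 hα hβ hαβ, ?_⟩
        have : α • p1 + β • p2 - q = α • (p1 - q) + β • (p2 - q) := by
          have e : β = 1 - α := by linarith
          rw [e]; module
        rw [this]
        exact D.add_mem (D.smul_mem _ h1.2) (D.smul_mem _ h2.2)
      have hFc : IsCompact F := by
        have hcl : IsClosed {p : Pt d | p - q ∈ D} :=
          (Submodule.closed_of_finiteDimensional D).preimage (f := fun p => p - q) (by fun_prop)
        exact hc.inter_right hcl
      have hFE : F.extremePoints ℝ ⊆ P.extremePoints ℝ := hFe.extremePoints_subset_extremePoints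
      have hvD : v - q ∉ D := by
        rintro ⟨τ, hτ, -, h2⟩
        have : v + (s + τ * s) • (y - v) ∈ P := by
          convert h2 using 1
          rw [hq]; module
        have := hsmax _ this
        have : 0 < τ * s := by positivity
        linarith
      have hFD : vectorSpan ℝ F ≤ D := by
        rw [vectorSpan_eq_span_vsub_set_right ℝ hqF, Submodule.span_le]
        rintro _ ⟨p, hp, rfl⟩
        exact hp.2
      have hlt : vectorSpan ℝ F < vectorSpan ℝ P := by
        refine lt_of_le_of_ne (vectorSpan_mono ℝ hFe.subset) fun h => hvD (hFD ?_)
        rw [h]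
        exact vsub_mem_vectorSpan ℝ hvE.1 hsP
      have hrF : Module.finrank ℝ (vectorSpan ℝ F) ≤ m := by
        have := Submodule.finrank_lt_finrank_of_lt hlt
        omega
      set b' := b - (a + b) * ε with hb'
      have hbb : b * ((m + 1) / (m + 2)) ≤ b' := by
        have h1 : (a + b) * ε ≤ (a + b) * η := by gcongr
        rw [hηe] at h1
        have h2 : b * ((m + 1) / (m + 2)) = b - b / (m + 2) := by field_simp; ring
        rw [h2]; linarith
      have hb'0 : 0 < b' := lt_of_lt_of_le (by positivity) hbb
      have hb'b : b' ≤ b := by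
        have : 0 ≤ (a + b) * ε := by positivity
        linarith
      have hLpos : 0 < L := by
        by_contra h
        push Not at h
        have h1 : b ^ 2 * L ≤ 0 := mul_nonpos_of_nonneg_of_nonpos (by positivity) h
        have h2 : 0 < 1 / 2 * ((m : ℝ) + 1) ^ 2 * (m + 1 + 1) * (a + b) := by positivity
        linarith
      have hL' : (1 / 2 : ℝ) * (m : ℝ) ^ 2 * ((m : ℝ) + 1) * (a + b') ≤ b' ^ 2 * L := by
        have h1 : (b * ((m + 1) / (m + 2))) ^ 2 * L ≤ b' ^ 2 * L := by gcongr
        refine le_trans ?_ h1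
        have h2 : (b * (((m : ℝ) + 1) / (m + 2))) ^ 2 * L
            = ((m + 1) / (m + 2)) ^ 2 * (b ^ 2 * L) := by ring
        rw [h2]
        have h3 : (((m : ℝ) + 1) / (m + 2)) ^ 2 * (1 / 2 * ((m : ℝ) + 1) ^ 2 * (m + 1 + 1) * (a + b))
          ≤ ((m + 1) / (m + 2)) ^ 2 * (b ^ 2 * L) := by gcongr
        refine le_trans ?_ h3
        have hab : a + b' ≤ a + b := by linarith
        exact aux_num hm0 (by positivity) (by positivity) hab
      obtain ⟨v', hv', p1, hp1, p2, hp2, hlat, heq⟩ := ih F hFc hFv (hf.subset hFE) hrF a b' L hb'0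
        (hb'b.trans hba) hL'
        (fun v hv w hw hed => hg v (hFE hv) w (hFE hw) ⟨hed.1, hFe.trans hed.2⟩) q hqF
      refine ⟨v', hFE hv', p1, hp1.1, ((a + b) * ε / b) • v + (b' / b) • p2, ?_, hlat, ?_⟩
      · refine hv hvE.1 hp2.1 (by positivity) (by positivity) ?_
        rw [hb']; field_simp; ring
      · have e1 : (a + b) * (1 - ε) = a + b' := by rw [hb']; ring
        rw [hyε, smul_add, smul_smul, smul_smul, e1, heq, smul_add, smul_smul, smul_smul,
          mul_div_cancel₀ _ hb.ne', mul_div_cancel₀ _ hb.ne']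
        abel

lemma aux_rat {v w : Pt d} (hv : IsRatPt v) (hw : IsRatPt w) (hne : v ≠ w) :
    ∃ (u : Fin d → ℤ) (t : ℝ), 0 < t ∧ IsPrimitive u ∧ ∀ i, w i - v i = t * (u i : ℝ) := by
  choose a ha using hv
  choose b hb using hw
  set D : ℕ := ∏ i, (b i - a i).den with hD
  have hD0 : 0 < D := Finset.prod_pos fun i _ => (b i - a i).den_pos
  have hint : ∀ i, ∃ n : ℤ, (D : ℚ) * (b i - a i) = n := by
    intro i
    obtain ⟨k, hk⟩ := Finset.dvd_prod_of_mem (fun i => (b i - a i).den) (Finset.mem_univ i)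
    refine ⟨k * (b i - a i).num, ?_⟩
    rw [hD, hk]
    push_cast
    rw [mul_comm ((b i - a i).den : ℚ) k, mul_assoc, mul_comm ((b i - a i).den : ℚ), Rat.mul_den_eq_num]
  choose n hn using hint
  have hreal : ∀ i, (D : ℝ) * (w i - v i) = n i := by
    intro i
    have := congrArg (fun q : ℚ => (q : ℝ)) (hn i)
    push_cast at this
    rw [ha, hb]; exact this
  have hD0' : (0 : ℝ) < D := by exact_mod_cast hD0
  have hnz : ∃ i, n i ≠ 0 := by
    by_contra h
    push Not at h
    apply hne
    ext i
    have := hreal i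
    rw [h i] at this
    simp only [Int.cast_zero, mul_eq_zero, hD0'.ne', false_or] at this
    linarith
  obtain ⟨i0, hi0⟩ := hnz
  obtain ⟨u, hu, hu1⟩ := Finset.univ.extract_gcd n ⟨i0, Finset.mem_univ i0⟩
  set g := Finset.univ.gcd n with hg
  have hg0 : 0 < g := by
    have h1 : 0 ≤ g := by
      have : normalize g = g := Finset.normalize_gcd
      rw [← this, ← Int.abs_eq_normalize]; exact abs_nonneg _
    refine lt_of_le_of_ne h1 fun h => hi0 ?_
    rw [hu i0 (Finset.mem_univ _), ← h, zero_mul]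
  refine ⟨u, (g : ℝ) / D, div_pos (by exact_mod_cast hg0) hD0', hu1, fun i => ?_⟩
  have h1 := hreal i
  rw [hu i (Finset.mem_univ _)] at h1
  push_cast at h1
  field_simp
  linarith

end Aux

/-- Theorem 1.2. A rational `d`-polytope all of whose edges have lattice
length at least `(1/2)·d²·(d+1)·k` is `k`-convex-normal. -/
theorem statement0 (d : ℕ) (hd : 0 < d) (k : ℚ) (hk : 2 ≤ k)
    (P : Set (Pt d)) (hP : IsRationalPolytope P) (hdim : polyDim P = d)
    (hedges : EdgeLengthsGE P ((1 / 2 : ℝ) * (d : ℝ) ^ 2 * ((d : ℝ) + 1) * (k : ℝ))) :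
    ConvexNormal k P := by

  obtain ⟨V, hV, rfl⟩ := hP
  set P := convexHull ℝ (V : Set (Pt d)) with hPd
  have hc : IsCompact P := V.finite_toSet.isCompact_convexHull ℝ
  have hv : Convex ℝ P := convex_convexHull ℝ _
  have hEV : P.extremePoints ℝ ⊆ V := extremePoints_convexHull_subset
  have hf : (P.extremePoints ℝ).Finite := V.finite_toSet.subset hEV
  intro c hc2 hck
  have hc2' : (2 : ℝ) ≤ c := by exact_mod_cast hc2
  have hck' : (c : ℝ) ≤ k := by exact_mod_cast hck
  apply Subset.antisymm
  · rintro _ ⟨y, hy, rfl⟩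
    obtain ⟨v, hvE, p1, hp1, p2, hp2, hlat, heq⟩ := aux_main d P hc hv hf hdim.le ((c : ℝ) - 1) 1
      ((1 / 2 : ℝ) * (d : ℝ) ^ 2 * ((d : ℝ) + 1) * (k : ℝ)) one_pos (by linarith)
      (by rw [sub_add_cancel, one_pow, one_mul]; gcongr)
      (by
        intro v hv w hw hed
        obtain ⟨u, t, ht, hu, h⟩ := aux_rat (hV v (hEV hv)) (hV w (hEV hw)) hed.1
        refine ⟨t, hedges v w hed u t ht hu h, WithLp.toLp 2 (fun i => (u i : ℝ)), fun i => ⟨u i, rfl⟩, ?_⟩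
        ext i
        simpa using h i) y hy
    refine ⟨v, hvE, ((c : ℝ) - 1) • p1, ⟨p1, hp1, rfl⟩, hlat, p2, hp2, ?_⟩
    rw [sub_add_cancel, one_smul] at heq
    exact heq
  · rintro y ⟨v, -, x, ⟨p1, hp1, rfl⟩, -, p, hp, rfl⟩
    have hc0 : (0 : ℝ) < c := by linarith
    refine ⟨(((c : ℝ) - 1) / c) • p1 + (1 / (c : ℝ)) • p,
      hv hp1 hp (div_nonneg (by linarith) hc0.le) (by positivity) (by field_simp; ring), ?_⟩
    simp only [smul_add, smul_smul]
    rw [mul_div_cancel₀ _ hc0.ne', mul_one_div_cancel hc0.ne', one_smul]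
end
end

section
/- Let d be a positive integer and let P ⊂ ℝ^d be a lattice polytope of dimension d (not necessarily simple). If every edge of P has lattice length at least 2d²(d+1), then P is integrally closed. -/
open Set Metric Pointwise

noncomputable section

section Cone
variable {E : Type*} [AddCommGroup E] [Module ℝ E]

/-- feasible directions of `K` at `q`. -/
def fdirs (K : Set E) (q : E) : Set E := {u | ∃ s : ℝ, 0 < s ∧ q + s • u ∈ K}

theorem fdirs_add {K : Set E} (hK : Convex ℝ K) {q u v : E} (hu : u ∈ fdirs K q)
    (hv : v ∈ fdirs K q) : u + v ∈ fdirs K q := by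
  obtain ⟨s, hs, h1⟩ := hu
  obtain ⟨t, ht, h2⟩ := hv
  refine ⟨s * t / (s + t), by positivity, ?_⟩
  have h3 := hK h1 h2 (a := t / (s + t)) (b := s / (s + t)) (by positivity) (by positivity)
    (by field_simp; ring)
  convert h3 using 1
  have e : s + t ≠ 0 := by positivity
  match_scalars <;> field_simp
  ring

theorem fdirs_zero {K : Set E} {q : E} (hq : q ∈ K) : (0 : E) ∈ fdirs K q :=
  ⟨1, one_pos, by simpa using hq⟩

theorem fdirs_smul {K : Set E} {q u : E} (hq : q ∈ K) (hu : u ∈ fdirs K q) {r : ℝ} (hr : 0 ≤ r) :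
    r • u ∈ fdirs K q := by
  rcases hr.eq_or_lt with rfl | hr
  · simpa using fdirs_zero hq
  obtain ⟨s, hs, h1⟩ := hu
  refine ⟨s / r, by positivity, ?_⟩
  rwa [smul_smul, div_mul_cancel₀ _ hr.ne']

theorem fdirs_sub {K : Set E} {q p : E} (hp : p ∈ K) : p - q ∈ fdirs K q :=
  ⟨1, one_pos, by simpa using hp⟩

theorem fdirs_le {K : Set E} (hK : Convex ℝ K) {q u : E} (hq : q ∈ K) {s t : ℝ}
    (ht : 0 ≤ t) (hts : t ≤ s) (h : q + s • u ∈ K) : q + t • u ∈ K := by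
  rcases ht.eq_or_lt with rfl | ht
  · simpa using hq
  have hs : 0 < s := ht.trans_le hts
  have h3 := hK hq h (a := 1 - t / s) (b := t / s) (by
    rw [sub_nonneg, div_le_one hs]; exact hts) (by positivity) (by ring)
  convert h3 using 1
  match_scalars <;> field_simp
  ring

/-- lineality space of feasible directions -/
def linSp (K : Set E) (hK : Convex ℝ K) (q : E) (hq : q ∈ K) : Submodule ℝ E where
  carrier := {u | u ∈ fdirs K q ∧ -u ∈ fdirs K q}
  add_mem' := by
    rintro a b ⟨h1, h2⟩ ⟨h3, h4⟩
    refine ⟨fdirs_add hK h1 h3, ?_⟩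
    rw [neg_add]
    exact fdirs_add hK h2 h4
  zero_mem' := ⟨fdirs_zero hq, by simpa using fdirs_zero hq⟩
  smul_mem' := by
    rintro c u ⟨h1, h2⟩
    rcases le_total 0 c with h | h
    · exact ⟨fdirs_smul hq h1 h, by simpa using fdirs_smul hq h2 h⟩
    · have h' : 0 ≤ -c := by linarith
      exact ⟨by simpa using fdirs_smul hq h2 h', by simpa using fdirs_smul hq h1 h'⟩

/-- The minimal face of `K` at `q`. -/
def minFace (K : Set E) (q : E) : Set E := {p ∈ K | q - p ∈ fdirs K q}

theorem minFace_self {K : Set E} {q : E} (hq : q ∈ K) : q ∈ minFace K q :=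
  ⟨hq, by simpa using fdirs_zero hq⟩

theorem minFace_lin {K : Set E} (hK : Convex ℝ K) {q p : E} (hq : q ∈ K) (hp : p ∈ minFace K q) :
    p - q ∈ linSp K hK q hq := ⟨fdirs_sub hp.1, by simpa using hp.2⟩

theorem minFace_extreme {K : Set E} (hK : Convex ℝ K) {q : E} (hq : q ∈ K) :
    IsExtreme ℝ K (minFace K q) := by
  refine ⟨fun x hx => hx.1, ?_⟩
  rintro x hx y hy z hz ⟨a, b, ha, hb, hab, rfl⟩
  refine ⟨hx, ?_⟩
  have h1 := fdirs_smul hq (fdirs_add hK hz.2 (fdirs_smul hq (fdirs_sub (q := q) hy) hb.le))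
    (r := a⁻¹) (by positivity)
  convert h1 using 1
  obtain rfl : b = 1 - a := by linarith
  match_scalars <;> field_simp <;> ring

theorem minFace_convex {K : Set E} (hK : Convex ℝ K) {q : E} (hq : q ∈ K) :
    Convex ℝ (minFace K q) := by
  rintro x hx y hy a b ha hb hab
  refine ⟨hK hx.1 hy.1 ha hb hab, ?_⟩
  have h1 := fdirs_add hK (fdirs_smul hq hx.2 ha) (fdirs_smul hq hy.2 hb)
  convert h1 using 1
  obtain rfl : b = 1 - a := by linarith
  module

theorem fdirs_sum {K : Set E} (hK : Convex ℝ K) {q : E} (hq : q ∈ K) {ι : Type*} (s : Finset ι)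
    (f : ι → E) (hf : ∀ i ∈ s, f i ∈ fdirs K q) : ∑ i ∈ s, f i ∈ fdirs K q :=
  Finset.sum_induction f (· ∈ fdirs K q) (fun _ _ => fdirs_add hK) (fdirs_zero hq) hf

theorem minFace_hull (V : Finset E) {q : E} (hq : q ∈ convexHull ℝ (V : Set E)) :
    ∃ V' ⊆ V, minFace (convexHull ℝ (V : Set E)) q = convexHull ℝ (V' : Set E) := by
  classical
  set K := convexHull ℝ (V : Set E) with hKdef
  have hK : Convex ℝ K := convex_convexHull ℝ _
  refine ⟨V.filter (· ∈ minFace K q), Finset.filter_subset _ _, ?_⟩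
  apply Subset.antisymm
  · intro p hp
    obtain ⟨w, hw0, hw1, hwp⟩ := Finset.mem_convexHull'.1 hp.1
    have key : ∀ v ∈ V, w v ≠ 0 → v ∈ minFace K q := by
      intro v hv hwv
      have hpos : 0 < w v := lt_of_le_of_ne (hw0 v hv) (Ne.symm hwv)
      refine ⟨subset_convexHull ℝ _ hv, ?_⟩
      have h1 : ∑ k ∈ V.erase v, w k • (k - q) ∈ fdirs K q := fdirs_sum hK hq _ _ fun k hk =>
        fdirs_smul hq (fdirs_sub (subset_convexHull ℝ _ (Finset.mem_of_mem_erase hk)))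
          (hw0 k (Finset.mem_of_mem_erase hk))
      have h2 := fdirs_smul hq (fdirs_add hK hp.2 h1) (r := (w v)⁻¹) (by positivity)
      convert h2 using 1
      have h3 : ∑ k ∈ V, w k • (k - q) = p - q := by
        simp only [smul_sub, Finset.sum_sub_distrib, hwp, ← Finset.sum_smul, hw1, one_smul]
      rw [← Finset.add_sum_erase V _ hv] at h3
      have h4 : ∑ k ∈ V.erase v, w k • (k - q) = p - q - w v • (v - q) := by
        rw [← h3]; abel
      rw [h4]
      match_scalars <;> field_simp <;> ring
    refine Finset.mem_convexHull'.2 ⟨w, fun y hy => hw0 y (Finset.mem_filter.1 hy).1, ?_, ?_⟩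
    · rw [← hw1]
      refine Finset.sum_subset (Finset.filter_subset _ _) fun x hx hx' => ?_
      by_contra h
      exact hx' (Finset.mem_filter.2 ⟨hx, key x hx h⟩)
    · rw [← hwp]
      refine Finset.sum_subset (Finset.filter_subset _ _) fun x hx hx' => ?_
      by_contra h
      exact hx' (Finset.mem_filter.2 ⟨hx, key x hx fun h' => h (by simp [h'])⟩)
  · refine convexHull_min ?_ (minFace_convex hK hq)
    intro x hx
    exact (Finset.mem_filter.1 hx).2

theorem vectorSpan_minFace_le {K : Set E} (hK : Convex ℝ K) {q : E} (hq : q ∈ K) :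
    vectorSpan ℝ (minFace K q) ≤ linSp K hK q hq := by
  rw [vectorSpan_eq_span_vsub_set_right ℝ (minFace_self hq), Submodule.span_le]
  rintro _ ⟨p, hp, rfl⟩
  exact minFace_lin hK hq hp

theorem vectorSpan_minFace_lt {K : Set E} (hK : Convex ℝ K) {q w : E} (hq : q ∈ K) (hw : w ∈ K)
    (hwF : w ∉ minFace K q) :
    vectorSpan ℝ (minFace K q) < vectorSpan ℝ K := by
  refine lt_of_le_of_ne (vectorSpan_mono ℝ fun x hx => hx.1) fun h => hwF ⟨hw, ?_⟩
  have h1 : w - q ∈ vectorSpan ℝ K := vsub_mem_vectorSpan ℝ hw hq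
  rw [← h] at h1
  have := (vectorSpan_minFace_le hK hq h1).2
  simpa using this

end Cone

theorem exists_edge {d : ℕ} (V : Finset (Pt d)) (f : Pt d →ₗ[ℝ] ℝ) {v w : Pt d}
    (hv : v ∈ convexHull ℝ (V : Set (Pt d))) (hw : w ∈ convexHull ℝ (V : Set (Pt d)))
    (hvw : f v < f w) :
    ∃ p ∈ V, ∃ q ∈ V, f p < f q ∧ IsExtreme ℝ (convexHull ℝ (V : Set (Pt d))) (segment ℝ p q) := by
  classical
  set K := convexHull ℝ (V : Set (Pt d)) with hKdef
  have hK : Convex ℝ K := convex_convexHull ℝ _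
  have hKc : IsCompact K := V.finite_toSet.isCompact_convexHull ℝ
  have hfc : Continuous f := f.continuous_of_finiteDimensional
  obtain ⟨m, ⟨hm1, hm2⟩, hmV⟩ : ∃ m, m ∈ Ioo (f v) (f w) ∧ m ∉ (f '' (V : Set (Pt d))) := by
    have := ((Ioo_infinite hvw).sdiff (V.finite_toSet.image f)).nonempty
    exact this
  have hSc : IsCompact (K ∩ f ⁻¹' {m}) := hKc.inter_right (isClosed_singleton.preimage hfc)
  have hSn : (K ∩ f ⁻¹' {m}).Nonempty := by
    obtain ⟨x, hx, hxm⟩ := (hK.isPreconnected.image f hfc.continuousOn).Icc_subset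
      (mem_image_of_mem f hv) (mem_image_of_mem f hw) ⟨hm1.le, hm2.le⟩
    exact ⟨x, hx, hxm⟩
  obtain ⟨q, hq⟩ := hSc.extremePoints_nonempty hSn
  have hqK : q ∈ K := hq.1.1
  have hqm : f q = m := hq.1.2
  set F := minFace K q with hF
  have hinj : ∀ x ∈ F, ∀ y ∈ F, f x = f y → x = y := by
    intro x hx y hy hxy
    have hl : x - y ∈ linSp K hK q hqK := by
      have := sub_mem (minFace_lin hK hqK hx) (minFace_lin hK hqK hy)
      simpa using this
    obtain ⟨⟨s, hs, h1⟩, ⟨t, ht, h2⟩⟩ := hl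
    have hmem : ∀ r : ℝ, f (q + r • (x - y)) = m := by
      intro r; simp [hxy, hqm]
    have h3 : q + (min s t) • (x - y) ∈ K := fdirs_le hK hqK (by positivity) (min_le_left _ _) h1
    have h4 : q + (min s t) • (-(x - y)) ∈ K := fdirs_le hK hqK (by positivity) (min_le_right _ _) h2
    have h5 := hq.2 (x₁ := q + (min s t) • (x - y)) ⟨h3, hmem _⟩
      (x₂ := q + (min s t) • (-(x - y))) ⟨h4, by
        have := hmem (-(min s t)); rwa [neg_smul, ← smul_neg] at this⟩ (by
        refine ⟨1/2, 1/2, by norm_num, by norm_num, by norm_num, by module⟩)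
    have h6 : (min s t) • (x - y) = 0 := by simpa using h5
    have : (min s t) ≠ 0 := by positivity
    rw [smul_eq_zero_iff_right this] at h6
    exact sub_eq_zero.1 h6
  obtain ⟨V', hV', hFV⟩ := minFace_hull V hqK
  have hqF : q ∈ F := minFace_self hqK
  have hVF : ∀ x ∈ V', x ∈ F := fun x hx => by
    rw [hF, hFV]; exact subset_convexHull ℝ _ hx
  have hne : V'.Nonempty := by
    rw [Finset.nonempty_iff_ne_empty]
    rintro rfl
    have : q ∈ convexHull ℝ ((∅ : Finset (Pt d)) : Set (Pt d)) := by rw [← hFV]; exact hqF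
    simp at this
  obtain ⟨a, ha, hamin⟩ := V'.exists_min_image f hne
  obtain ⟨b, hb, hbmax⟩ := V'.exists_max_image f hne
  have hrange : ∀ x ∈ F, f x ∈ Icc (f a) (f b) := by
    have : F ⊆ f ⁻¹' (Icc (f a) (f b)) := by
      rw [hF, hFV]
      refine convexHull_min (fun x hx => ⟨hamin x hx, hbmax x hx⟩) ?_
      exact (convex_Icc _ _).linear_preimage f
    exact fun x hx => this hx
  have hFc : Convex ℝ F := minFace_convex hK hqK
  have hseg : segment ℝ a b ⊆ F := hFc.segment_subset (hVF a ha) (hVF b hb)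
  have hFseg : F = segment ℝ a b := by
    refine Subset.antisymm (fun x hx => ?_) hseg
    have h1 := hrange x hx
    have h2 : f x ∈ segment ℝ (f a) (f b) := by
      rw [segment_eq_Icc (h1.1.trans h1.2)]; exact h1
    have h3 : f x ∈ f '' segment ℝ a b := by
      have := image_segment ℝ f.toAffineMap a b
      simp only [LinearMap.coe_toAffineMap] at this
      rw [this]; exact h2
    obtain ⟨y, hy, hyx⟩ := h3
    rw [hinj x hx y (hseg hy) hyx.symm]; exact hy
  refine ⟨a, hV' ha, b, hV' hb, ?_, hFseg ▸ minFace_extreme hK hqK⟩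
  refine lt_of_le_of_ne (hamin b hb) fun h => ?_
  have hab := hinj a (hVF a ha) b (hVF b hb) h
  have : q ∈ segment ℝ a b := hFseg ▸ hqF
  rw [← hab, segment_same, mem_singleton_iff] at this
  exact hmV ⟨a, hV' ha, by rw [← this, hqm]⟩

theorem lattice_edge {d : ℕ} {v w : Pt d} {L : ℝ} (hL : LatLenGE v w L) (hv : IsLatticePt v)
    (hw : IsLatticePt w) (hvw : v ≠ w) :
    ∃ u : Pt d, IsLatticePt u ∧ ∃ t : ℝ, 0 < t ∧ L ≤ t ∧ w - v = t • u := by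
  choose n hn using hv
  choose k hk using hw
  obtain ⟨i, hi⟩ : ∃ i, v i ≠ w i := by
    by_contra! h; exact hvw (PiLp.ext h)
  have hki : k i - n i ≠ 0 := by
    intro h
    apply hi
    rw [hn, hk]; congr 1; omega
  obtain ⟨g, hg, hg1⟩ := Finset.extract_gcd (s := Finset.univ) (fun i => k i - n i)
    ⟨i, Finset.mem_univ _⟩
  set D := Finset.univ.gcd (fun i => k i - n i) with hD
  have hD0 : D ≠ 0 := by
    intro h
    have := hg i (Finset.mem_univ _)
    rw [h, zero_mul] at this
    exact hki this
  have hDn : 0 ≤ D := by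
    have : normalize D = D := Finset.normalize_gcd
    rw [← this, ← Int.abs_eq_normalize]; exact abs_nonneg _
  have hDpos : (0 : ℝ) < D := by exact_mod_cast lt_of_le_of_ne hDn (Ne.symm hD0)
  have he : ∀ j, w j - v j = (D : ℝ) * (g j : ℝ) := by
    intro j
    rw [hn, hk, ← Int.cast_sub, ← Int.cast_mul]; exact congrArg _ (hg j (Finset.mem_univ _))
  refine ⟨WithLp.toLp 2 (fun j => (g j : ℝ)), fun j => ⟨g j, rfl⟩, D, hDpos, hL g D hDpos hg1 he, ?_⟩
  ext j
  simpa using he j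

theorem IsLatticePt.zero {d : ℕ} : IsLatticePt (0 : Pt d) := fun _ => ⟨0, by simp⟩

theorem IsLatticePt.add {d : ℕ} {x y : Pt d} (hx : IsLatticePt x) (hy : IsLatticePt y) :
    IsLatticePt (x + y) := fun i => by
  obtain ⟨n, hn⟩ := hx i
  obtain ⟨m, hm⟩ := hy i
  exact ⟨n + m, by simp [hn, hm]⟩

theorem IsLatticePt.zsmul {d : ℕ} {x : Pt d} (hx : IsLatticePt x) (k : ℤ) :
    IsLatticePt ((k : ℝ) • x) := fun i => by
  obtain ⟨n, hn⟩ := hx i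
  exact ⟨k * n, by simp [hn]⟩

theorem IsLatticePt.sub {d : ℕ} {x y : Pt d} (hx : IsLatticePt x) (hy : IsLatticePt y) :
    IsLatticePt (x - y) := by
  have := hx.add (hy.zsmul (-1))
  simpa [sub_eq_add_neg] using this

theorem IsLatticePt.sum {d : ℕ} {ι : Type*} (s : Finset ι) (f : ι → Pt d)
    (h : ∀ i ∈ s, IsLatticePt (f i)) : IsLatticePt (∑ i ∈ s, f i) :=
  Finset.sum_induction f IsLatticePt (fun _ _ => IsLatticePt.add) IsLatticePt.zero h

theorem add_sum_mem {E ι : Type*} [AddCommGroup E] [Module ℝ E] {K : Set E} (hK : Convex ℝ K)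
    {y : E} (hy : y ∈ K) {η : ℝ} (s : Finset ι) (c : ι → ℝ) (g : ι → E)
    (hc : ∀ i ∈ s, 0 ≤ c i) (hsum : ∑ i ∈ s, c i ≤ η) (hg : ∀ i ∈ s, y + η • g i ∈ K) :
    y + ∑ i ∈ s, c i • g i ∈ K := by
  rcases (Finset.sum_nonneg hc).eq_or_lt with h | h
  · have : ∀ i ∈ s, c i = 0 := (Finset.sum_eq_zero_iff_of_nonneg hc).1 h.symm
    rw [Finset.sum_eq_zero fun i hi => by rw [this i hi, zero_smul]]
    simpa using hy
  · set S := ∑ i ∈ s, c i with hS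
    have h1 : ∑ i ∈ s, (c i / S) • (y + η • g i) ∈ K :=
      hK.sum_mem (fun i hi => div_nonneg (hc i hi) h.le)
        (by rw [← Finset.sum_div, ← hS, div_self h.ne']) hg
    have h2 : ∑ i ∈ s, (c i / S) • (y + η • g i) = y + (η / S) • ∑ i ∈ s, c i • g i := by
      simp only [smul_add, Finset.sum_add_distrib, ← Finset.sum_smul, ← Finset.sum_div]
      rw [← hS, div_self h.ne', one_smul, Finset.smul_sum]
      congr 1
      refine Finset.sum_congr rfl fun i _ => ?_
      rw [smul_smul, smul_smul]
      congr 1; ring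
    rw [h2] at h1
    have h3 := fdirs_le hK hy zero_le_one ((one_le_div h).2 hsum) h1
    simpa using h3

theorem deep_case {d : ℕ} (V : Finset (Pt d)) (hV : ∀ v ∈ V, IsLatticePt v) {L : ℝ} (hL : 0 < L)
    (hedge : ∀ p ∈ V, ∀ q ∈ V, p ≠ q →
      IsExtreme ℝ (convexHull ℝ (V : Set (Pt d))) (segment ℝ p q) → LatLenGE p q L)
    {η b : ℝ} {a : ℕ} (ha : 0 < a) (hb : 0 < b) {y : Pt d}
    (hy : y ∈ convexHull ℝ (V : Set (Pt d)))
    (hdeep : ∀ p ∈ convexHull ℝ (V : Set (Pt d)), ∀ w ∈ convexHull ℝ (V : Set (Pt d)),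
      y + η • (p - w) ∈ convexHull ℝ (V : Set (Pt d)))
    (h1 : (Module.finrank ℝ (vectorSpan ℝ (convexHull ℝ (V : Set (Pt d)))) : ℝ) ≤ η * (a * L))
    (h2 : (Module.finrank ℝ (vectorSpan ℝ (convexHull ℝ (V : Set (Pt d)))) : ℝ) ≤ η * (b * L)) :
    ∃ x ∈ convexHull ℝ (V : Set (Pt d)), ∃ p ∈ convexHull ℝ (V : Set (Pt d)),
      IsLatticePt ((a : ℝ) • x) ∧ ((a : ℝ) + b) • y = (a : ℝ) • x + b • p := by
  classical
  set K := convexHull ℝ (V : Set (Pt d)) with hKdef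
  have hK : Convex ℝ K := convex_convexHull ℝ _
  set S : Set (Pt d) := {u | IsLatticePt u ∧ ∃ t : ℝ, 0 < t ∧ L ≤ t ∧ ∃ p ∈ K, ∃ q ∈ K,
    q - p = t • u} with hS
  have hspan : vectorSpan ℝ K = Submodule.span ℝ S := by
    apply le_antisymm
    · intro z hz
      by_contra hcon
      obtain ⟨f, hf, hker⟩ := Submodule.exists_le_ker_of_notMem hcon
      have hconst : ∀ v ∈ K, ∀ w ∈ K, ¬ f v < f w := by
        intro v hv w hw hvw
        obtain ⟨p, hp, q, hq, hpq, hext⟩ := exists_edge V f hv hw hvw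
        have hne : p ≠ q := by rintro rfl; exact lt_irrefl _ hpq
        obtain ⟨u, hu, t, ht, hLt, he⟩ := lattice_edge (hedge p hp q hq hne hext) (hV p hp)
          (hV q hq) hne
        have huS : u ∈ S := ⟨hu, t, ht, hLt, p, subset_convexHull ℝ _ hp, q,
          subset_convexHull ℝ _ hq, he⟩
        have hfu : f u = 0 := hker (Submodule.subset_span huS)
        have := congrArg f he
        rw [map_sub, map_smul, hfu, smul_zero] at this
        linarith
      have hle : vectorSpan ℝ K ≤ LinearMap.ker f := by
        rw [vectorSpan_def, Submodule.span_le]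
        rintro _ ⟨v, hv, w, hw, rfl⟩
        have e1 := hconst v hv w hw
        have e2 := hconst w hw v hv
        simp only [SetLike.mem_coe, LinearMap.mem_ker, vsub_eq_sub, map_sub]
        linarith
      exact hf (hle hz)
    · rw [Submodule.span_le]
      rintro u ⟨-, t, ht, -, p, hp, q, hq, he⟩
      have : u = t⁻¹ • (q - p) := by rw [he, smul_smul, inv_mul_cancel₀ ht.ne', one_smul]
      rw [this]
      exact Submodule.smul_mem _ _ (vsub_mem_vectorSpan ℝ hq hp)
  obtain ⟨B, hBS, hBspan, hBli⟩ := exists_linearIndependent ℝ S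
  have hBfin : B.Finite := hBli.setFinite
  lift B to Finset (Pt d) using hBfin
  have hcard : Module.finrank ℝ (vectorSpan ℝ K) = B.card := by
    rw [hspan, ← hBspan]
    exact finrank_span_finset_eq_card hBli
  rw [hcard] at h1 h2
  obtain ⟨v0, hv0⟩ : V.Nonempty := by
    rw [Finset.nonempty_iff_ne_empty]
    rintro rfl
    simp [hKdef] at hy
  have hmem : (a : ℝ) • (y - v0) ∈ Submodule.span ℝ (B : Set (Pt d)) := by
    rw [hBspan, ← hspan]
    exact Submodule.smul_mem _ _ (vsub_mem_vectorSpan ℝ hy (subset_convexHull ℝ _ hv0))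
  obtain ⟨α, -, hα⟩ := Submodule.mem_span_finset.1 hmem
  have hB : ∀ u, ∃ t : ℝ, ∃ p q : Pt d, u ∈ B →
      (IsLatticePt u ∧ 0 < t ∧ L ≤ t ∧ p ∈ K ∧ q ∈ K ∧ q - p = t • u) := by
    intro u
    by_cases hu : u ∈ B
    · obtain ⟨h, t, ht, hLt, p, hp, q, hq, he⟩ := hBS hu
      exact ⟨t, p, q, fun _ => ⟨h, ht, hLt, hp, hq, he⟩⟩
    · exact ⟨0, 0, 0, fun h => absurd h hu⟩
  choose t p q hB using hB
  have ha' : (0 : ℝ) < a := by exact_mod_cast ha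
  have hcoef : ∀ r : ℝ, 0 < r → (B.card : ℝ) ≤ η * (r * L) →
      ∑ u ∈ B, Int.fract (α u) / (r * t u) ≤ η := by
    intro r hr hle
    calc ∑ u ∈ B, Int.fract (α u) / (r * t u) ≤ ∑ u ∈ B, 1 / (r * L) := by
          refine Finset.sum_le_sum fun u hu => ?_
          obtain ⟨-, h3, h4, -⟩ := hB u hu
          have := (Int.fract_lt_one (α u)).le
          gcongr
      _ = B.card / (r * L) := by rw [Finset.sum_const, nsmul_eq_mul]; ring
      _ ≤ η := by rw [div_le_iff₀ (by positivity)]; exact hle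
  have hnn : ∀ r : ℝ, 0 < r → ∀ u ∈ B, 0 ≤ Int.fract (α u) / (r * t u) := by
    intro r hr u hu
    obtain ⟨-, h3, h4, -⟩ := hB u hu
    have := Int.fract_nonneg (α u)
    positivity
  set R := ∑ u ∈ B, Int.fract (α u) • u with hR
  have hx : y + ∑ u ∈ B, (Int.fract (α u) / (a * t u)) • (p u - q u) ∈ K :=
    add_sum_mem hK hy B _ _ (hnn a ha') (hcoef a ha' h1) fun u hu =>
      hdeep _ (hB u hu).2.2.2.1 _ (hB u hu).2.2.2.2.1
  have hp' : y + ∑ u ∈ B, (Int.fract (α u) / (b * t u)) • (q u - p u) ∈ K :=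
    add_sum_mem hK hy B _ _ (hnn b hb) (hcoef b hb h2) fun u hu =>
      hdeep _ (hB u hu).2.2.2.2.1 _ (hB u hu).2.2.2.1
  have ex : (a : ℝ) • (y + ∑ u ∈ B, (Int.fract (α u) / (a * t u)) • (p u - q u))
      = (a : ℝ) • y - R := by
    rw [smul_add, sub_eq_add_neg, hR, Finset.smul_sum, ← Finset.sum_neg_distrib]
    congr 1
    refine Finset.sum_congr rfl fun u hu => ?_
    obtain ⟨-, h3, -, -, -, h4⟩ := hB u hu
    rw [← neg_sub (q u) (p u), h4, smul_neg, smul_neg, smul_smul, smul_smul]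
    congr 2
    field_simp
  have ep : b • (y + ∑ u ∈ B, (Int.fract (α u) / (b * t u)) • (q u - p u)) = b • y + R := by
    rw [smul_add, hR, Finset.smul_sum]
    congr 1
    refine Finset.sum_congr rfl fun u hu => ?_
    obtain ⟨-, h3, -, -, -, h4⟩ := hB u hu
    rw [h4, smul_smul, smul_smul]
    congr 1
    field_simp
  refine ⟨_, hx, _, hp', ?_, ?_⟩
  · rw [ex]
    have : (a : ℝ) • y - R = (a : ℝ) • v0 + ∑ u ∈ B, ((⌊α u⌋ : ℤ) : ℝ) • u := by
      have e1 : (a : ℝ) • y = (a : ℝ) • v0 + ∑ u ∈ B, α u • u := by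
        rw [hα]; module
      rw [e1, hR, add_sub_assoc, ← Finset.sum_sub_distrib]
      congr 1
      refine Finset.sum_congr rfl fun u _ => ?_
      rw [← sub_smul, Int.self_sub_fract]
    rw [this]
    refine IsLatticePt.add ?_ (IsLatticePt.sum _ _ fun u hu => (hB u hu).1.zsmul _)
    have := (hV v0 hv0).zsmul (a : ℤ)
    simpa using this
  · rw [ex, ep]; module

theorem main_lemma {d : ℕ} (P : Set (Pt d)) {a : ℕ} (ha : 0 < a) (had : a + 1 ≤ d)
    (hedges : EdgeLengthsGE P (2 * (d : ℝ) ^ 2 * ((d : ℝ) + 1))) :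
    ∀ n : ℕ, ∀ V : Finset (Pt d), (∀ v ∈ V, IsLatticePt v) →
      IsExtreme ℝ P (convexHull ℝ (V : Set (Pt d))) →
      Module.finrank ℝ (vectorSpan ℝ (convexHull ℝ (V : Set (Pt d)))) = n →
      ∀ b : ℝ, ((n : ℝ) + 1) / (d + 1) ≤ b → b ≤ 1 → ∀ y ∈ convexHull ℝ (V : Set (Pt d)),
      ∃ x ∈ convexHull ℝ (V : Set (Pt d)), ∃ p ∈ convexHull ℝ (V : Set (Pt d)),
        IsLatticePt ((a : ℝ) • x) ∧ ((a : ℝ) + b) • y = (a : ℝ) • x + b • p := by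
  intro n
  induction n using Nat.strong_induction_on with
  | _ n ih =>
  intro V hV hext hn b hb hb1 y hy
  set K := convexHull ℝ (V : Set (Pt d)) with hKdef
  have hK : Convex ℝ K := convex_convexHull ℝ _
  have hKc : IsCompact K := V.finite_toSet.isCompact_convexHull ℝ
  have ha1 : (1 : ℝ) ≤ a := by exact_mod_cast ha
  have had' : (a : ℝ) + 1 ≤ d := by exact_mod_cast had
  have hd1 : (0 : ℝ) < d := by linarith
  have hbpos : 0 < b := lt_of_lt_of_le (by positivity) hb
  set ε : ℝ := 1 / (d + 1) with hε
  have hεpos : 0 < ε := by positivity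
  have hεb : (n + 1) * ε ≤ b := by rw [hε]; convert hb using 1; ring
  have hε1 : ε ≤ b := le_trans (by nlinarith [(Nat.cast_nonneg n : (0 : ℝ) ≤ n)]) hεb
  set N : ℝ := a + b with hN
  have hNε : 0 < N - ε := by linarith
  have hNpos : 0 < N := by linarith
  by_cases hdeep : ∀ w ∈ K, (N - ε)⁻¹ • (N • y - ε • w) ∈ K
  · have hy' : ∀ p ∈ K, ∀ w ∈ K, y + (ε / N) • (p - w) ∈ K := by
      intro p hp w hw
      have := hK (hdeep w hw) hp (a := (N - ε) / N) (b := ε / N) (by positivity) (by positivity)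
        (by field_simp; ring)
      convert this using 1
      match_scalars <;> field_simp
    have hbL : (n : ℝ) ≤ ε / N * (b * (2 * (d : ℝ) ^ 2 * ((d : ℝ) + 1))) := by
      have hNd : N ≤ d := by linarith
      rw [div_mul_eq_mul_div, le_div_iff₀ hNpos, hε]
      have e : 1 / ((d : ℝ) + 1) * (b * (2 * (d : ℝ) ^ 2 * ((d : ℝ) + 1))) = 2 * d ^ 2 * b := by
        field_simp
      rw [e]
      have h3 : (n : ℝ) * N ≤ n * d := by gcongr
      have h4 : (n + 1 : ℝ) ≤ b * (d + 1) := by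
        rwa [div_le_iff₀ (by positivity)] at hb
      have h5 : (n : ℝ) ≤ 2 * d * b := by nlinarith
      nlinarith
    refine deep_case V hV (L := 2 * (d : ℝ) ^ 2 * ((d : ℝ) + 1)) (by positivity) ?_ ha hbpos hy hy'
      ?_ ?_
    · intro p _ q _ hpq hseg
      exact hedges p q ⟨hpq, hext.trans hseg⟩
    · rw [← hKdef, hn]
      refine hbL.trans ?_
      have : b ≤ a := by linarith
      gcongr
    · rw [← hKdef, hn]; exact hbL
  · push Not at hdeep
    obtain ⟨w, hw, hwε⟩ := hdeep
    set g : ℝ → Pt d := fun t => (N - t)⁻¹ • (N • y - t • w) with hg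
    have hgc : ContinuousOn g (Icc 0 ε) := by
      apply ContinuousOn.fun_smul
      · apply ContinuousOn.inv₀ (by fun_prop)
        intro t ht
        have := ht.2
        linarith
      · fun_prop
    have hA : IsCompact (Icc 0 ε ∩ g ⁻¹' K) :=
      isCompact_Icc.of_isClosed_subset (hgc.preimage_isClosed_of_isClosed isClosed_Icc hKc.isClosed)
        inter_subset_left
    have hAn : (Icc 0 ε ∩ g ⁻¹' K).Nonempty := by
      refine ⟨0, ⟨le_rfl, hεpos.le⟩, ?_⟩
      simpa [hg, smul_smul, inv_mul_cancel₀ hNpos.ne'] using hy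
    obtain ⟨t, ⟨⟨ht0, htε⟩, htK⟩, htmax⟩ := hA.exists_isGreatest hAn
    have htlt : t < ε := by
      refine lt_of_le_of_ne htε ?_
      rintro rfl
      exact hwε htK
    set q := g t with hq
    have hqK : q ∈ K := htK
    have hNt : 0 < N - t := by linarith
    have hqeq : (N - t) • q = N • y - t • w := by
      rw [hq, hg]; simp only; rw [smul_smul, mul_inv_cancel₀ hNt.ne', one_smul]
    have hwF : w ∉ minFace K q := by
      rintro ⟨-, s, hs, hsK⟩
      set δ := min (ε - t) (s * (N - ε)) with hδ
      have hδpos : 0 < δ := lt_min (by linarith) (by positivity)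
      have hδ1 : δ ≤ ε - t := min_le_left _ _
      have hδ2 : δ ≤ s * (N - ε) := min_le_right _ _
      have hNd : 0 < N - (t + δ) := by linarith
      have h1 : q + (δ / (N - (t + δ))) • (q - w) ∈ K := by
        refine fdirs_le hK hqK (by positivity) ?_ hsK
        rw [div_le_iff₀ hNd]
        nlinarith
      have h2 : g (t + δ) = q + (δ / (N - (t + δ))) • (q - w) := by
        have : N • y = (N - t) • q + t • w := by rw [hqeq]; abel
        simp only [hg]
        rw [this]
        match_scalars <;> field_simp <;> ring
      have h3 : t + δ ∈ Icc 0 ε ∩ g ⁻¹' K := ⟨⟨by linarith, by linarith⟩, by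
        rw [mem_preimage, h2]; exact h1⟩
      have := htmax h3
      linarith
    obtain ⟨V', hV', hFV⟩ := minFace_hull V hqK
    have hlt : Module.finrank ℝ (vectorSpan ℝ (minFace K q)) < n := by
      rw [← hn]
      exact Submodule.finrank_lt_finrank_of_lt (vectorSpan_minFace_lt hK hqK hw hwF)
    have hFK : minFace K q ⊆ K := fun x hx => hx.1
    have hqF := minFace_self hqK
    have hFe := hext.trans (minFace_extreme hK hqK)
    rw [← hKdef] at hFV
    rw [hFV] at hlt hFK hqF hFe
    have hb' : ((Module.finrank ℝ (vectorSpan ℝ (convexHull ℝ (V' : Set (Pt d)))) : ℝ) + 1)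
        / (d + 1) ≤ b - t := by
      have h6 : (Module.finrank ℝ (vectorSpan ℝ (convexHull ℝ (V' : Set (Pt d)))) : ℝ) + 1 ≤ n := by
        exact_mod_cast hlt
      calc _ ≤ (n : ℝ) / (d + 1) := by gcongr
        _ = (n + 1) * ε - ε := by rw [hε]; ring
        _ ≤ b - t := by linarith
    obtain ⟨x, hx, f, hf, hlat, heq⟩ := ih _ hlt V' (fun v hv => hV v (hV' hv)) hFe rfl (b - t) hb'
      (by linarith) q hqF
    have hbt : 0 ≤ b - t := by linarith
    refine ⟨x, hFK hx, ((b - t) / b) • f + (t / b) • w,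
      hK (hFK hf) hw (by positivity) (by positivity) (by field_simp; ring), hlat, ?_⟩
    have h7 : N • y = (N - t) • q + t • w := by rw [hqeq]; abel
    have h8 : (N - t) • q = (a : ℝ) • x + (b - t) • f := by
      rw [← heq, hN]; congr 1; ring
    rw [h7, h8, smul_add, smul_smul, smul_smul, mul_div_cancel₀ _ hbpos.ne',
      mul_div_cancel₀ _ hbpos.ne', add_assoc]

theorem step_lemma {d : ℕ} (P : Set (Pt d)) (hP : IsLatticePolytope P) (hdim : polyDim P = d)
    (hedges : EdgeLengthsGE P (2 * (d : ℝ) ^ 2 * ((d : ℝ) + 1))) {a : ℕ} (ha : 0 < a)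
    {y : Pt d} (hy : y ∈ P) (hlat : IsLatticePt (((a : ℝ) + 1) • y)) :
    ∃ x ∈ P, ∃ p ∈ P, IsLatticePt ((a : ℝ) • x) ∧ IsLatticePt p ∧
      ((a : ℝ) + 1) • y = (a : ℝ) • x + p := by
  obtain ⟨V, hV, rfl⟩ := hP
  have ha' : (0 : ℝ) < a := by exact_mod_cast ha
  rcases le_or_gt (a + 1) d with had | had
  · obtain ⟨x, hx, p, hp, hl, he⟩ := main_lemma _ ha had hedges d V hV (IsExtreme.refl ℝ _) hdim 1
      (by rw [div_self (by positivity)]) le_rfl y hy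
    rw [one_smul] at he
    refine ⟨x, hx, p, hp, hl, ?_, he⟩
    have : p = ((a : ℝ) + 1) • y - (a : ℝ) • x := by rw [he]; abel
    rw [this]
    exact hlat.sub hl
  · obtain ⟨ι, _, z, w, hz, hai, hw0, hw1, hwy⟩ := eq_pos_convex_span_of_mem_convexHull hy
    have hcard : Fintype.card ι ≤ d + 1 := by
      have := hai.card_le_finrank_succ
      refine this.trans ?_
      have h := Submodule.finrank_le (vectorSpan ℝ (range z))
      simp at h
      omega
    obtain ⟨i, hi⟩ : ∃ i, 1 ≤ ((a : ℝ) + 1) * w i := by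
      by_contra! h
      have hne : Nonempty ι := by
        by_contra hne
        rw [not_nonempty_iff] at hne
        simp at hw1
      have h1 : ∑ i, ((a : ℝ) + 1) * w i < ∑ i : ι, (1 : ℝ) :=
        Finset.sum_lt_sum_of_nonempty Finset.univ_nonempty fun i _ => h i
      rw [← Finset.mul_sum, hw1] at h1
      simp at h1
      have h2 : a + 1 < Fintype.card ι := by exact_mod_cast h1
      omega
    have hziV : z i ∈ V := hz (mem_range_self i)
    have hzi : z i ∈ convexHull ℝ (V : Set (Pt d)) := subset_convexHull ℝ _ hziV
    have hzl := hV _ hziV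
    classical
    have hxK : (a : ℝ)⁻¹ • (((a : ℝ) + 1) • y - z i) ∈ convexHull ℝ (V : Set (Pt d)) := by
      have h1 : ∑ k, ((((a : ℝ) + 1) * w k - if k = i then 1 else 0) / a) • z k ∈
          convexHull ℝ (V : Set (Pt d)) := by
        refine (convex_convexHull ℝ _).sum_mem ?_ ?_ fun k _ =>
          subset_convexHull ℝ _ (hz (mem_range_self k))
        · intro k _
          split_ifs with hk
          · subst hk; exact div_nonneg (by linarith) ha'.le
          · have := hw0 k
            rw [sub_zero]
            positivity
        · rw [← Finset.sum_div, Finset.sum_sub_distrib, ← Finset.mul_sum, hw1]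
          simp [ha'.ne']
      convert h1 using 1
      rw [← hwy, Finset.smul_sum, inv_smul_eq_iff₀ ha'.ne', Finset.smul_sum]
      have : z i = ∑ k, (if k = i then (1 : ℝ) else 0) • z k := by simp
      rw [this, ← Finset.sum_sub_distrib]
      refine Finset.sum_congr rfl fun k _ => ?_
      match_scalars <;> field_simp
    have e : (a : ℝ) • (a : ℝ)⁻¹ • (((a : ℝ) + 1) • y - z i) = ((a : ℝ) + 1) • y - z i := by
      rw [smul_smul, mul_inv_cancel₀ ha'.ne', one_smul]
    refine ⟨_, hxK, z i, hzi, ?_, hzl, ?_⟩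
    · rw [e]; exact hlat.sub hzl
    · rw [e]; abel

/-- Theorem 1.3(a). A lattice `d`-polytope all of whose edges have lattice
length at least `2d²(d+1)` is integrally closed. -/
theorem statement1 (d : ℕ) (hd : 0 < d)
    (P : Set (Pt d)) (hP : IsLatticePolytope P) (hdim : polyDim P = d)
    (hedges : EdgeLengthsGE P (2 * (d : ℝ) ^ 2 * ((d : ℝ) + 1))) :
    IntegrallyClosed P := by
  intro c hc
  induction c, hc using Nat.le_induction with
  | base =>
    rintro z ⟨y, hy, rfl⟩ hlat
    refine ⟨fun _ => y, fun _ => ⟨hy, by simpa using hlat⟩, by simp⟩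
  | succ a ha ih =>
    rintro z ⟨y, hy, rfl⟩ hlat
    simp only [Nat.cast_add, Nat.cast_one] at hlat ⊢
    obtain ⟨x, hx, p, hp, hxl, hpl, he⟩ := step_lemma P hP hdim hedges ha hy hlat
    obtain ⟨f, hf, hsum⟩ := ih ((a : ℝ) • x) (smul_mem_smul_set hx) hxl
    refine ⟨Fin.snoc f p, fun i => ?_, ?_⟩
    · refine Fin.lastCases ?_ (fun j => ?_) i
      · simpa using ⟨hp, hpl⟩
      · simpa using hf j
    · rw [Fin.sum_univ_castSucc]
      simp [hsum, he]
end
end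

section
/- Let d ≥ 2 be an integer, k ∈ ℚ with k ≥ 2, and λ ∈ ℚ with λ > 0. Assume that every rational polytope Q ⊂ ℝ^d of dimension d−1 all of whose edges have lattice length at least (d/(d+1))·λ satisfies, for every rational c with 2 ≤ c ≤ k + (k−1)/d, the equality cQ = ⋃ (x + Q), the union over all vertices v of Q and all x ∈ (c−1)Q ∩ ((c−1)v + ℤ^d). Then every rational polytope P ⊂ ℝ^d of dimension d all of whose edges have lattice length at least λ satisfies BCN(d,k): for every facet F of P, every rational c with 2 ≤ c ≤ k, and ε_F = width_F(P)/(d+1), one has U_{cP}(cF, ε_F) ⊆ ⋃ (x + P), the union over all vertices v of P and all x ∈ (c−1)P ∩ ((c−1)v + ℤ^d). -/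
open Set Metric Pointwise

noncomputable section

lemma aux_fin_closed {d : ℕ} (W : Finset (Pt d)) : IsCompact (convexHull ℝ (W : Set (Pt d))) :=
  W.finite_toSet.isCompact_convexHull (𝕜 := ℝ)

lemma aux_polyDim_hull {d : ℕ} (W : Set (Pt d)) :
    polyDim (convexHull ℝ W) = Module.finrank ℝ (vectorSpan ℝ W) := by
  unfold polyDim
  rw [← direction_affineSpan, affineSpan_convexHull, direction_affineSpan]

lemma aux_face {d : ℕ} (V : Finset (Pt d)) (f : Pt d →L[ℝ] ℝ) (M : ℝ)
    (hM : ∀ x ∈ convexHull ℝ (V : Set (Pt d)), f x ≤ M) :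
    ∃ W ⊆ V, IsExtreme ℝ (convexHull ℝ (V : Set (Pt d))) (convexHull ℝ (W : Set (Pt d))) ∧
      (∀ w ∈ W, f w = M) ∧
      ∀ x ∈ convexHull ℝ (V : Set (Pt d)), f x = M → x ∈ convexHull ℝ (W : Set (Pt d)) := by
  classical
  set P := convexHull ℝ (V : Set (Pt d)) with hP
  set G := P ∩ {x | f x = M} with hG
  have hGe : IsExtreme ℝ P G := by
    refine ⟨inter_subset_left, ?_⟩
    rintro x hx y hy z ⟨hz, hzM⟩ ⟨a, b, ha, hb, hab, rfl⟩
    refine ⟨hx, ?_⟩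
    have h1 := hM x hx
    have h2 := hM y hy
    simp only [mem_ofPred_eq, map_add, map_smul, smul_eq_mul] at hzM ⊢
    have hb' : b = 1 - a := by linarith
    subst hb'
    by_contra hne
    have : f x < M := lt_of_le_of_ne h1 hne
    nlinarith
  have hcl : IsClosed {x | f x = M} := isClosed_eq f.continuous continuous_const
  have hGc : IsCompact G := (aux_fin_closed V).inter_right hcl
  have hGconv : Convex ℝ G := (convex_convexHull ℝ _).inter
    (convex_hyperplane f.toLinearMap.isLinear M)
  set W := V.filter (fun x => f x = M) with hW
  have hGW : G = convexHull ℝ (W : Set (Pt d)) := by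
    apply Subset.antisymm
    · rw [← closure_convexHull_extremePoints hGc hGconv]
      refine closure_minimal ?_ (aux_fin_closed W).isClosed
      refine convexHull_mono ?_
      intro x hx
      have h1 := extremePoints_convexHull_subset (hGe.extremePoints_subset_extremePoints hx)
      have h2 : f x = M := hx.1.2
      simp only [hW, Finset.coe_filter, mem_ofPred_eq]
      exact ⟨h1, h2⟩
    · refine convexHull_min ?_ hGconv
      intro x hx
      simp only [hW, Finset.coe_filter, mem_ofPred_eq] at hx
      exact ⟨subset_convexHull ℝ _ hx.1, hx.2⟩
  refine ⟨W, Finset.filter_subset _ _, hGW ▸ hGe, ?_, ?_⟩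
  · intro w hw
    exact (Finset.mem_filter.1 hw).2
  · intro x hx hxM
    rw [← hGW]
    exact ⟨hx, hxM⟩

lemma aux_top {d : ℕ} {P : Set (Pt d)} (h : polyDim P = d) (hne : P.Nonempty) :
    affineSpan ℝ P = ⊤ := by
  rw [AffineSubspace.affineSpan_eq_top_iff_vectorSpan_eq_top_of_nonempty ℝ (Pt d) (Pt d) hne]
  apply Submodule.eq_top_of_finrank_eq
  rw [finrank_euclideanSpace_fin]
  exact h

lemma aux_exit {d : ℕ} {P : Set (Pt d)} (hc : IsCompact P) {z u : Pt d} 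
    (hu : u ∈ P) (hzu : u ≠ z) :
    ∃ g ∈ P, g ∉ interior P ∧ u ∈ segment ℝ g z := by
  set γ : ℝ → Pt d := fun t => z + t • (u - z) with hγ
  have hγc : Continuous γ := by fun_prop
  have hpos : 0 < ‖u - z‖ := norm_pos_iff.2 (sub_ne_zero.2 hzu)
  obtain ⟨R, hR⟩ := hc.isBounded.exists_norm_le
  set T := {t : ℝ | 1 ≤ t ∧ γ t ∈ P} with hT
  have hTc : IsCompact T := by
    refine Metric.isCompact_of_isClosed_isBounded ?_ ?_
    · exact isClosed_Ici.inter (hc.isClosed.preimage hγc)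
    · refine (isBounded_Icc (1:ℝ) ((R + ‖z‖) / ‖u - z‖)).subset ?_
      rintro t ⟨h1, h2⟩
      refine ⟨h1, ?_⟩
      rw [le_div_iff₀ hpos]
      have h3 := hR _ h2
      have h4 : ‖t • (u - z)‖ ≤ ‖γ t‖ + ‖z‖ := by
        have : t • (u - z) = γ t - z := by simp [hγ]
        rw [this]; exact norm_sub_le _ _
      rw [norm_smul, Real.norm_eq_abs, abs_of_nonneg (by linarith)] at h4
      linarith
  have hTn : T.Nonempty := ⟨1, le_rfl, by simpa [hγ] using hu⟩
  obtain ⟨t, ⟨ht1, htP⟩, htmax⟩ := hTc.exists_isMaxOn hTn continuousOn_id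
  refine ⟨γ t, htP, ?_, ?_⟩
  · intro hint
    have : γ ⁻¹' (interior P) ∈ nhds t :=
      hγc.continuousAt.preimage_mem_nhds (isOpen_interior.mem_nhds hint)
    obtain ⟨e, he, hsub⟩ := Metric.mem_nhds_iff.1 this
    have hm : t + e / 2 ∈ Metric.ball t e := by
      rw [Metric.mem_ball, Real.dist_eq, add_sub_cancel_left, abs_of_pos (by linarith)]
      linarith
    have h1 : t + e/2 ∈ T := ⟨by linarith, interior_subset (hsub hm)⟩
    have := htmax h1
    simp at this
    linarith
  · have ht0 : t ≠ 0 := by linarith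
    have htp : 0 < t := by linarith
    refine ⟨1/t, 1 - 1/t, by positivity, ?_, by ring, ?_⟩
    · have : 1 / t ≤ 1 := by rw [div_le_one htp]; exact ht1
      linarith
    · simp only [hγ, smul_add, smul_smul, sub_smul, one_smul]
      rw [one_div, inv_mul_cancel₀ ht0, one_smul]
      abel

lemma aux_cover {d : ℕ} (hd : 2 ≤ d) (V : Finset (Pt d))
    (hdim : polyDim (convexHull ℝ (V : Set (Pt d))) = d) (z u : Pt d)
    (hz : z ∈ convexHull ℝ (V : Set (Pt d))) (hu : u ∈ convexHull ℝ (V : Set (Pt d))) :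
    ∃ W ⊆ V, IsExtreme ℝ (convexHull ℝ (V : Set (Pt d))) (convexHull ℝ (W : Set (Pt d))) ∧
      polyDim (convexHull ℝ (W : Set (Pt d))) + 1 = d ∧
      ∃ g ∈ convexHull ℝ (W : Set (Pt d)), u ∈ segment ℝ g z := by
  classical
  set P := convexHull ℝ (V : Set (Pt d)) with hP
  have hPc : IsCompact P := aux_fin_closed V
  have hPconv : Convex ℝ P := convex_convexHull ℝ _
  have hint : (interior P).Nonempty :=
    hPconv.interior_nonempty_iff_affineSpan_eq_top.2 (aux_top hdim ⟨z, hz⟩)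
  set S : Finset (Finset (Pt d)) := V.powerset.filter
    (fun W => IsExtreme ℝ P (convexHull ℝ (W : Set (Pt d))) ∧
      polyDim (convexHull ℝ (W : Set (Pt d))) + 1 = d) with hS
  set K : Set (Pt d) := ⋃ W ∈ S, convexHull ℝ (insert z (W : Set (Pt d))) with hK
  have hKc : IsClosed K := by
    refine isClosed_biUnion_finset ?_
    intro W _
    have := (aux_fin_closed (insert z W)).isClosed
    rwa [Finset.coe_insert] at this
  -- the bad set
  have hbad : ∀ᵐ x ∂(MeasureTheory.volume : MeasureTheory.Measure (Pt d)),
      ∀ W ∈ V.powerset, affineSpan ℝ (insert z (W : Set (Pt d))) ≠ ⊤ →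
        x ∉ affineSpan ℝ (insert z (W : Set (Pt d))) := by
    rw [Finset.eventually_all]
    intro W _
    by_cases h : affineSpan ℝ (insert z (W : Set (Pt d))) = ⊤
    · simp [h]
    · have := MeasureTheory.Measure.addHaar_affineSubspace MeasureTheory.volume _ h
      filter_upwards [MeasureTheory.measure_eq_zero_iff_ae_notMem.1 this] with x hx _
      exact hx
  have hdense := MeasureTheory.Measure.dense_of_ae hbad
  have hsub : P ⊆ K := by
    have h1 : P = closure (interior P) := by
      rw [hPconv.closure_interior_eq_closure_of_nonempty_interior hint, hPc.isClosed.closure_eq]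
    rw [h1]
    refine closure_minimal ?_ hKc
    refine (hdense.open_subset_closure_inter isOpen_interior).trans ?_
    refine closure_minimal ?_ hKc
    rintro x ⟨hxi, hxb⟩
    have hxP := interior_subset hxi
    have hxz : x ≠ z := by
      intro hxz
      refine hxb ∅ (by simp) ?_ ?_
      · intro h
        have h2 : Module.finrank ℝ (affineSpan ℝ (insert z ((∅ : Finset (Pt d)) : Set (Pt d)))).direction
            = d := by
          rw [h, AffineSubspace.direction_top, finrank_top, finrank_euclideanSpace_fin]
        rw [direction_affineSpan, Finset.coe_empty, insert_empty_eq, vectorSpan_singleton,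
          finrank_bot] at h2
        omega
      · rw [hxz]; exact mem_affineSpan ℝ (mem_insert _ _)
    obtain ⟨g, hgP, hgi, hseg⟩ := aux_exit hPc hxP hxz
    obtain ⟨f, hf⟩ := geometric_hahn_banach_open_point hPconv.interior isOpen_interior hgi
    have hfP : ∀ a ∈ P, f a ≤ f g := by
      intro a ha
      rw [h1] at ha
      have : closure (interior P) ⊆ {a | f a ≤ f g} :=
        closure_minimal (fun a ha => (hf a ha).le) (isClosed_le f.continuous continuous_const)
      exact this ha
    obtain ⟨W, hWV, hWe, hWM, hWmem⟩ := aux_face V f (f g) hfP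
    have hgW := hWmem g hgP rfl
    have hxW : x ∈ convexHull ℝ (insert z (W : Set (Pt d))) := by
      refine (convex_convexHull ℝ _).segment_subset ?_ ?_ hseg
      · exact convexHull_mono (subset_insert _ _) hgW
      · exact subset_convexHull ℝ _ (mem_insert _ _)
    refine mem_biUnion (x := W) ?_ hxW
    rw [Finset.mem_coe, hS, Finset.mem_filter, Finset.mem_powerset]
    refine ⟨hWV, hWe, ?_⟩
    rw [aux_polyDim_hull]
    have htop : affineSpan ℝ (insert z (W : Set (Pt d))) = ⊤ := by
      by_contra h
      exact hxb W (Finset.mem_powerset.2 hWV) h (convexHull_subset_affineSpan _ hxW)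
    have h2 : Module.finrank ℝ (vectorSpan ℝ (insert z (W : Set (Pt d)))) = d := by
      rw [← direction_affineSpan, htop, AffineSubspace.direction_top, finrank_top,
        finrank_euclideanSpace_fin]
    have h3 := finrank_vectorSpan_insert_le_set ℝ (W : Set (Pt d)) z
    rw [h2] at h3
    have h4 : vectorSpan ℝ (W : Set (Pt d)) < ⊤ := by
      rw [lt_top_iff_ne_top]
      intro htop
      have hle : vectorSpan ℝ (W : Set (Pt d)) ≤ LinearMap.ker f.toLinearMap := by
        rw [vectorSpan_def, Submodule.span_le]
        rintro _ ⟨a, ha, b, hb, rfl⟩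
        simp [hWM a ha, hWM b hb]
      rw [htop, top_le_iff] at hle
      obtain ⟨a, ha⟩ := hint
      have h5 := hf a ha
      have h6 : ∀ y, f y = 0 := fun y => by
        have : y ∈ LinearMap.ker f.toLinearMap := by rw [hle]; trivial
        simpa using this
      rw [h6, h6] at h5
      exact lt_irrefl _ h5
    have h5 := Submodule.finrank_lt h4.ne
    rw [finrank_euclideanSpace_fin] at h5
    omega
  obtain ⟨W, hWS, huW⟩ := mem_iUnion₂.1 (hsub hu)
  rw [hS, Finset.mem_filter, Finset.mem_powerset] at hWS
  refine ⟨W, hWS.1, hWS.2.1, hWS.2.2, ?_⟩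
  have hWn : (W : Set (Pt d)).Nonempty := by
    rw [nonempty_iff_ne_empty]
    intro h
    have := hWS.2.2
    rw [aux_polyDim_hull, h, vectorSpan_empty] at this
    simp at this
    omega
  rw [convexHull_insert hWn, mem_convexJoin] at huW
  obtain ⟨a, ha, b, hb, hab⟩ := huW
  rw [mem_singleton_iff] at ha
  subst ha
  exact ⟨b, hb, by rwa [segment_symm]⟩

lemma aux_vs_le {d : ℕ} (c : ℝ) (A : Set (Pt d)) : vectorSpan ℝ (c • A) ≤ vectorSpan ℝ A := by
  rw [vectorSpan_def, Submodule.span_le]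
  rintro _ ⟨_, ⟨a, ha, rfl⟩, _, ⟨b, hb, rfl⟩, rfl⟩
  have : (c • a) -ᵥ (c • b) = c • (a -ᵥ b) := by simp [smul_sub]
  simp only [SetLike.mem_coe]
  rw [this]
  exact Submodule.smul_mem _ _ (vsub_mem_vectorSpan ℝ ha hb)

lemma aux_vs {d : ℕ} {c : ℝ} (hc : c ≠ 0) (A : Set (Pt d)) :
    vectorSpan ℝ (c • A) = vectorSpan ℝ A := by
  refine le_antisymm (aux_vs_le c A) ?_
  have := aux_vs_le c⁻¹ (c • A)
  rwa [inv_smul_smul₀ hc] at this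

lemma aux_mem_aff {d : ℕ} (A : Set (Pt d)) (n : Pt d) (a : Pt d) (ha : a ∈ A)
    (hS : ∀ v, inner ℝ n v = 0 ↔ v ∈ vectorSpan ℝ A) (x : Pt d) :
    x ∈ affineSpan ℝ A ↔ inner ℝ n (x - a) = 0 := by
  rw [hS, ← direction_affineSpan,
    ← AffineSubspace.vsub_right_mem_direction_iff_mem (mem_affineSpan ℝ ha)]
  rfl

lemma aux_infDist {d : ℕ} (A : Set (Pt d)) (n : Pt d) (hn : ‖n‖ = 1) (a : Pt d) (ha : a ∈ A)
    (hS : ∀ v, inner ℝ n v = 0 ↔ v ∈ vectorSpan ℝ A) (x : Pt d) :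
    infDist x ((affineSpan ℝ A : AffineSubspace ℝ (Pt d)) : Set (Pt d)) = |inner ℝ n (x - a)| := by
  have hmem := aux_mem_aff A n a ha hS
  apply le_antisymm
  · have h1 : x - (inner ℝ n (x - a) : ℝ) • n ∈ affineSpan ℝ A := by
      rw [hmem, sub_right_comm, inner_sub_right, inner_smul_right, real_inner_self_eq_norm_sq, hn]
      ring
    refine (infDist_le_dist_of_mem h1).trans ?_
    rw [dist_eq_norm, sub_sub_cancel, norm_smul, hn, mul_one, Real.norm_eq_abs]
  · rw [le_infDist ⟨a, mem_affineSpan ℝ ha⟩]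
    intro y hy
    have h2 := (hmem y).1 hy
    have : inner ℝ n (x - a) = inner ℝ n (x - y) := by
      have : x - a = (x - y) + (y - a) := by abel
      rw [this, inner_add_right, h2, add_zero]
    rw [this, dist_eq_norm]
    have := abs_real_inner_le_norm n (x - y)
    rwa [hn, one_mul] at this

lemma aux_normal {d : ℕ} (hd : 1 ≤ d) (S : Submodule ℝ (Pt d)) (h : Module.finrank ℝ S + 1 = d) :
    ∃ n : Pt d, ‖n‖ = 1 ∧ ∀ v, inner ℝ n v = 0 ↔ v ∈ S := by
  have h1 := S.finrank_add_finrank_orthogonal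
  rw [finrank_euclideanSpace_fin] at h1
  have h2 : Module.finrank ℝ Sᗮ = 1 := by omega
  have hne : Sᗮ ≠ ⊥ := by
    intro h
    rw [h, finrank_bot] at h2
    omega
  obtain ⟨m, hm, hm0⟩ := Submodule.exists_mem_ne_zero_of_ne_bot hne
  have hpos : ‖m‖ ≠ 0 := norm_ne_zero_iff.2 hm0
  have hspan : ∀ w ∈ Sᗮ, ∃ t : ℝ, t • m = w := by
    intro w hw
    obtain ⟨t, ht⟩ := (finrank_eq_one_iff_of_nonzero' (⟨m, hm⟩ : Sᗮ)
      (by simpa using hm0)).1 h2 ⟨w, hw⟩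
    exact ⟨t, congrArg Subtype.val ht⟩
  refine ⟨‖m‖⁻¹ • m, ?_, ?_⟩
  · rw [norm_smul, norm_inv, norm_norm, inv_mul_cancel₀ hpos]
  · intro v
    rw [inner_smul_left]
    constructor
    · intro h
      have h3 : inner ℝ m v = 0 := by
        rcases mul_eq_zero.1 h with h | h
        · exfalso
          simp at h
          exact hm0 h
        · exact h
      rw [← Submodule.orthogonal_orthogonal S, Submodule.mem_orthogonal]
      intro w hw
      obtain ⟨t, rfl⟩ := hspan w hw
      rw [inner_smul_left, h3, mul_zero]
    · intro hv
      rw [Submodule.inner_left_of_mem_orthogonal hv hm, mul_zero]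

/-- `P ∩ aff F ⊆ F` for a convex extreme set `F`. -/
lemma aux_inter {d : ℕ} {P F : Set (Pt d)} (hF : IsExtreme ℝ P F) (hc : Convex ℝ F)
    (hne : F.Nonempty) (m : Pt d) (hm : m ∈ P) (hmA : m ∈ affineSpan ℝ F) : m ∈ F := by
  obtain ⟨f, hf⟩ := hne.intrinsicInterior hc
  rw [mem_intrinsicInterior] at hf
  obtain ⟨y, hy, rfl⟩ := hf
  have hyF : (y : Pt d) ∈ F := by
    have h := interior_subset hy
    exact h
  by_cases hmy : m = (y : Pt d)
  · rw [hmy]; exact hyF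
  obtain ⟨e, he, hsub⟩ := Metric.mem_nhds_iff.1 (mem_interior_iff_mem_nhds.1 hy)
  have hD : 0 < dist m (y : Pt d) := dist_pos.2 hmy
  set t : ℝ := e / (2 * dist m (y : Pt d)) with ht
  have htp : 0 < t := by positivity
  set p : Pt d := AffineMap.lineMap m (y : Pt d) (1 + t) with hp
  have hpA : p ∈ affineSpan ℝ F := AffineMap.lineMap_mem _ hmA y.2
  have hpF : p ∈ F := by
    have : (⟨p, hpA⟩ : affineSpan ℝ F) ∈ Metric.ball y e := by
      rw [Metric.mem_ball, Subtype.dist_eq]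
      simp only [hp]
      rw [dist_lineMap_right]
      simp only [sub_add_cancel_left, norm_neg, Real.norm_eq_abs, abs_of_pos htp]
      rw [ht]
      have : e / (2 * dist m (y : Pt d)) * dist m (y : Pt d) = e / 2 := by
        field_simp
      rw [this]; linarith
    exact hsub this
  refine hF.left_mem_of_mem_openSegment hm (hF.subset hpF) hyF ?_
  refine ⟨t / (1 + t), 1 / (1 + t), by positivity, by positivity, by field_simp; ring, ?_⟩
  rw [hp, AffineMap.lineMap_apply_module, smul_add, smul_smul, smul_smul, ← add_assoc, ← add_smul]
  have h1 : t / (1 + t) + 1 / (1 + t) * (1 - (1 + t)) = 0 := by field_simp; ring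
  have h2 : 1 / (1 + t) * (1 + t) = 1 := by field_simp
  rw [h1, h2, zero_smul, zero_add, one_smul]

lemma aux_side {d : ℕ} {P F : Set (Pt d)} (hF : IsExtreme ℝ P F) (hP : Convex ℝ P)
    (hc : Convex ℝ F) (n a : Pt d) (ha : a ∈ F)
    (hS : ∀ v, inner ℝ n v = 0 ↔ v ∈ vectorSpan ℝ F) (p q : Pt d) (hp : p ∈ P) (hq : q ∈ P)
    (hpp : 0 < inner ℝ n (p - a)) : 0 ≤ inner ℝ n (q - a) := by
  by_contra! hqq
  set s := inner ℝ n (p - a) with hs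
  set t := inner ℝ n (q - a) with ht
  have hpos : 0 < s - t := by linarith
  set m : Pt d := (-t / (s - t)) • p + (s / (s - t)) • q with hm
  have hab : -t / (s - t) + s / (s - t) = 1 := by field_simp; ring
  have h1 : 0 < -t / (s - t) := div_pos (by linarith) hpos
  have h2 : 0 < s / (s - t) := div_pos (by linarith) hpos
  have hmP : m ∈ P := hP hp hq h1.le h2.le hab
  have hma : inner ℝ n (m - a) = 0 := by
    have : m - a = (-t / (s - t)) • (p - a) + (s / (s - t)) • (q - a) := by
      have : a = (-t / (s - t) + s / (s - t)) • a := by rw [hab, one_smul]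
      rw [hm]
      nth_rewrite 1 [this]
      module
    rw [this, inner_add_right, inner_smul_right, inner_smul_right, ← hs, ← ht]
    field_simp
    ring
  have hmF : m ∈ F := aux_inter hF hc ⟨a, ha⟩ m hmP ((aux_mem_aff F n a ha hS m).2 hma)
  have hpF : p ∈ F := hF.left_mem_of_mem_openSegment hp hq hmF ⟨_, _, h1, h2, hab, rfl⟩
  have := (hS _).2 (vsub_mem_vectorSpan ℝ hpF ha)
  rw [vsub_eq_sub, ← hs] at this
  linarith

/-- signed height function of a facet -/
lemma aux_height {d : ℕ} {P F : Set (Pt d)} (hd : 2 ≤ d) (hP : Convex ℝ P) (hdim : polyDim P = d)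
    (hF : IsFacetOf P F) :
    ∃ n a : Pt d, (∀ x ∈ P, 0 ≤ inner ℝ n (x - a)) ∧
      (∀ c : ℝ, 0 < c → ∀ x ∈ P,
        infDist (c • x) ((affineSpan ℝ (c • F) : AffineSubspace ℝ (Pt d)) : Set (Pt d))
          = c * inner ℝ n (x - a)) ∧ ∃ x ∈ P, 0 < inner ℝ n (x - a) := by
  obtain ⟨⟨hFe, hFc, -⟩, hFd⟩ := hF
  rw [hdim] at hFd
  have hne : F.Nonempty := by
    rw [nonempty_iff_ne_empty]
    rintro rfl
    rw [polyDim, vectorSpan_empty, finrank_bot] at hFd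
    omega
  obtain ⟨a, ha⟩ := hne
  obtain ⟨n0, hn0, hS0⟩ := aux_normal (by omega) _ hFd
  have hex : ∃ x ∈ P, inner ℝ n0 (x - a) ≠ 0 := by
    by_contra! hcon
    have hle : vectorSpan ℝ P ≤ vectorSpan ℝ F := by
      rw [vectorSpan_def, Submodule.span_le]
      rintro _ ⟨x, hx, y, hy, rfl⟩
      rw [SetLike.mem_coe, ← hS0]
      have : x -ᵥ y = (x - a) - (y - a) := by simp
      simp only
      rw [this, inner_sub_right, hcon x hx, hcon y hy, sub_zero]
    have := Submodule.finrank_mono hle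
    unfold polyDim at hdim hFd
    omega
  obtain ⟨x0, hx0, hx0n⟩ := hex
  have key : ∃ n : Pt d, ‖n‖ = 1 ∧ (∀ v, inner ℝ n v = 0 ↔ v ∈ vectorSpan ℝ F) ∧
      0 < inner ℝ n (x0 - a) := by
    rcases lt_or_gt_of_ne hx0n with h | h
    · refine ⟨-n0, by rwa [norm_neg], fun v => ?_, ?_⟩
      · rw [inner_neg_left, neg_eq_zero]; exact hS0 v
      · rw [inner_neg_left]; linarith
    · exact ⟨n0, hn0, hS0, h⟩
  obtain ⟨n, hn, hS, hpos⟩ := key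
  have hside : ∀ x ∈ P, 0 ≤ inner ℝ n (x - a) :=
    fun x hx => aux_side hFe hP hFc n a ha hS x0 x hx0 hx hpos
  refine ⟨n, a, hside, ?_, x0, hx0, hpos⟩
  intro c hc x hx
  rw [aux_infDist (c • F) n hn (c • a) (smul_mem_smul_set ha)
    (fun v => by rw [aux_vs hc.ne']; exact hS v), ← smul_sub, inner_smul_right,
    abs_of_nonneg (mul_nonneg hc.le (hside x hx))]

lemma aux_lattice_closed {d : ℕ} : IsClosed {x : Pt d | IsLatticePt x} := by
  have : {x : Pt d | IsLatticePt x} = ⋂ i, (fun x : Pt d => x i) ⁻¹' (range ((↑) : ℤ → ℝ)) := by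
    ext x
    simp [IsLatticePt, eq_comm]
  rw [this]
  refine isClosed_iInter fun i => ?_
  exact Int.isClosedEmbedding_coe_real.isClosed_range.preimage (by fun_prop)

lemma aux_cn_closed {d : ℕ} (V : Finset (Pt d)) (c : ℝ) :
    IsClosed (cnUnion (convexHull ℝ (V : Set (Pt d))) c) := by
  set P := convexHull ℝ (V : Set (Pt d)) with hP
  have hPc : IsCompact P := aux_fin_closed V
  have hfin : (P.extremePoints ℝ).Finite := V.finite_toSet.subset extremePoints_convexHull_subset
  have : cnUnion P c = ⋃ v ∈ P.extremePoints ℝ,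
      (((c - 1) • P ∩ {x | IsLatticePt (x - (c - 1) • v)}) + P) := by
    ext y
    simp only [cnUnion, mem_ofPred_eq, mem_iUnion, mem_add, mem_inter_iff, exists_prop]
    constructor
    · rintro ⟨v, hv, x, hx, hl, p, hp, rfl⟩
      exact ⟨v, hv, x, ⟨hx, hl⟩, p, hp, rfl⟩
    · rintro ⟨v, hv, x, ⟨hx, hl⟩, p, hp, rfl⟩
      exact ⟨v, hv, x, hx, hl, p, hp, rfl⟩
  rw [this]
  refine hfin.isClosed_biUnion fun v _ => ?_
  refine IsCompact.isClosed (IsCompact.add (IsCompact.inter_right (hPc.smul _) ?_) hPc)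
  exact aux_lattice_closed.preimage (by fun_prop : Continuous fun x : Pt d => x - (c - 1) • v)

lemma aux_extreme_smul {d : ℕ} {r : ℝ} (hr : 0 < r) {G A : Set (Pt d)}
    (h : IsExtreme ℝ (r • G) (r • A)) : IsExtreme ℝ G A := by
  refine ⟨(smul_set_subset_smul_set_iff₀ hr.ne').1 h.subset, ?_⟩
  rintro x hx y hy z hz ⟨s, t, hs, ht, hst, rfl⟩
  have := h.left_mem_of_mem_openSegment (smul_mem_smul_set hx) (smul_mem_smul_set hy)
    (smul_mem_smul_set hz) ⟨s, t, hs, ht, hst, by module⟩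
  exact (smul_mem_smul_set_iff₀ hr.ne' _ _).1 this

/-- The main step for a facet `G = conv W` and a rational ratio `r`. -/
lemma aux_main_s8 {d : ℕ} (hd : 2 ≤ d) (k lam : ℚ) (hlam : 0 < lam)
    (hyp : ∀ Q : Set (Pt d), IsRationalPolytope Q → polyDim Q = d - 1 →
      EdgeLengthsGE Q (((d : ℝ) / ((d : ℝ) + 1)) * (lam : ℝ)) →
      ∀ c : ℚ, 2 ≤ c → c ≤ k + (k - 1) / (d : ℚ) → (c : ℝ) • Q = cnUnion Q (c : ℝ))
    (V W : Finset (Pt d)) (hV : ∀ v ∈ V, IsRatPt v) (hWV : W ⊆ V)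
    (hWe : IsExtreme ℝ (convexHull ℝ (V : Set (Pt d))) (convexHull ℝ (W : Set (Pt d))))
    (hWd : polyDim (convexHull ℝ (W : Set (Pt d))) + 1 = d)
    (hedge : EdgeLengthsGE (convexHull ℝ (V : Set (Pt d))) (lam : ℝ))
    (c : ℚ) (hc2 : 2 ≤ c) (hck : c ≤ k) (r : ℚ) (hr1 : r ≤ 1) (hr : (d : ℚ) / (d + 1) ≤ r)
    (z g : Pt d) (hz : z ∈ convexHull ℝ (V : Set (Pt d)))
    (hg : g ∈ convexHull ℝ (W : Set (Pt d))) :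
    ((c : ℝ) - 1 + r) • g + (1 - (r : ℝ)) • z ∈ cnUnion (convexHull ℝ (V : Set (Pt d))) (c : ℝ) := by
  classical
  set P := convexHull ℝ (V : Set (Pt d)) with hP
  set G := convexHull ℝ (W : Set (Pt d)) with hG
  have hd0 : (0 : ℚ) < d := by exact_mod_cast (by omega : 0 < d)
  have hr0 : 0 < r := lt_of_lt_of_le (by positivity) hr
  have hr0' : (0 : ℝ) < r := by exact_mod_cast hr0
  have hr' : (d : ℝ) / (d + 1) ≤ r := by
    have h := (Rat.cast_le (K := ℝ)).2 hr
    push_cast at h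
    exact h
  have hr1' : (r : ℝ) ≤ 1 := by exact_mod_cast hr1
  have hlam' : (0 : ℝ) < lam := by exact_mod_cast hlam
  have hQr : IsRationalPolytope ((r : ℝ) • G) := by
    refine ⟨W.image (fun x => (r : ℝ) • x), ?_, ?_⟩
    · intro v hv
      obtain ⟨w, hw, rfl⟩ := Finset.mem_image.1 hv
      intro i
      obtain ⟨q, hq⟩ := hV w (hWV hw) i
      exact ⟨r * q, by simp [hq]⟩
    · rw [hG, ← convexHull_smul, Finset.coe_image]
      rfl
  have hQd : polyDim ((r : ℝ) • G) = d - 1 := by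
    unfold polyDim at hWd ⊢
    rw [aux_vs hr0'.ne']
    omega
  have hQe : EdgeLengthsGE ((r : ℝ) • G) (((d : ℝ) / ((d : ℝ) + 1)) * (lam : ℝ)) := by
    rintro v w ⟨hvw, hext⟩ u t ht hu hi
    have hseg : segment ℝ v w = (r : ℝ) • segment ℝ ((r : ℝ)⁻¹ • v) ((r : ℝ)⁻¹ • w) := by
      rw [← convexHull_pair, ← convexHull_pair, ← convexHull_smul]
      congr 1
      simp [smul_set_insert, smul_inv_smul₀ hr0'.ne']
    rw [hseg] at hext
    have h1 := hWe.trans (aux_extreme_smul hr0' hext)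
    have h2 := hedge _ _ ⟨by
      intro h
      exact hvw (smul_right_injective _ (inv_ne_zero hr0'.ne') h), h1⟩ u ((r : ℝ)⁻¹ * t)
      (by positivity) hu (fun i => by
        simp only [PiLp.smul_apply, smul_eq_mul]
        rw [← mul_sub, hi i, mul_assoc])
    have h3 : (lam : ℝ) * r ≤ t := by
      have := mul_le_mul_of_nonneg_left h2 hr0'.le
      rw [mul_inv_cancel_left₀ hr0'.ne'] at this
      linarith
    nlinarith
  have hc1 : 1 ≤ (c - 1) / r := by
    rw [le_div_iff₀ hr0]; linarith
  have hc3 : 1 + (c - 1) / r ≤ k + (k - 1) / d := by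
    have h1 : (c - 1) / r ≤ (k - 1) / (d / (d + 1)) := by
      apply div_le_div₀ (by linarith) (by linarith) (by positivity) hr
    have h2 : (k - 1) / ((d : ℚ) / (d + 1)) = (k - 1) + (k - 1) / d := by
      field_simp
    linarith
  have hcn := hyp _ hQr hQd hQe (1 + (c - 1) / r) (by linarith) hc3
  have hmem : ((c : ℝ) - 1 + r) • g ∈ ((1 + (c - 1) / r : ℚ) : ℝ) • ((r : ℝ) • G) := by
    refine ⟨(r : ℝ) • g, smul_mem_smul_set hg, ?_⟩
    simp only [smul_smul]
    congr 1
    push_cast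
    field_simp
    ring
  rw [hcn] at hmem
  obtain ⟨v, hv, x, hx, hl, p, ⟨q, hq, rfl⟩, hy⟩ := hmem
  have hcr : (((1 + (c - 1) / r : ℚ) : ℝ) - 1) * r = c - 1 := by
    push_cast
    field_simp
    ring
  obtain ⟨v0, hv0, rfl⟩ := hv.1
  rw [smul_smul, hcr] at hx
  simp only [smul_smul, hcr] at hl
  refine ⟨v0, ?_, x, ?_, hl, (r : ℝ) • q + (1 - (r : ℝ)) • z, ?_, ?_⟩
  · refine hWe.extremePoints_subset_extremePoints ?_
    rw [← isExtreme_singleton] at hv ⊢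
    apply aux_extreme_smul hr0'
    simpa using hv
  · exact smul_set_mono hWe.subset hx
  · exact convex_convexHull ℝ _ (hWe.subset hq) hz hr0'.le (by linarith) (by ring)
  · rw [hy]
    simp only
    abel

/-- Lemma 3.4. If every rational `(d-1)`-polytope with edges of lattice length
`≥ (d/(d+1))λ` satisfies `CN(d-1, k + (k-1)/d)`, then every rational `d`-polytope with edges of
lattice length `≥ λ` satisfies `BCN(d,k)`. -/
theorem statement8 (d : ℕ) (hd : 2 ≤ d) (k : ℚ) (hk : 2 ≤ k) (lam : ℚ) (hlam : 0 < lam)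
    (hyp : ∀ Q : Set (Pt d), IsRationalPolytope Q → polyDim Q = d - 1 →
      EdgeLengthsGE Q (((d : ℝ) / ((d : ℝ) + 1)) * (lam : ℝ)) →
      ∀ c : ℚ, 2 ≤ c → c ≤ k + (k - 1) / (d : ℚ) → (c : ℝ) • Q = cnUnion Q (c : ℝ)) :
    ∀ P : Set (Pt d), IsRationalPolytope P → polyDim P = d →
      EdgeLengthsGE P (lam : ℝ) → BCN k P := by
  rintro P ⟨V, hV, rfl⟩ hdim hedge F hF c hc2 hck y ⟨⟨u, hu, rfl⟩, hdist⟩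
  set P := convexHull ℝ (V : Set (Pt d)) with hP
  have hPc : IsCompact P := aux_fin_closed V
  have hPconv : Convex ℝ P := convex_convexHull ℝ _
  have hc0 : (0 : ℝ) < c := by
    have : (0 : ℚ) < c := by linarith
    exact_mod_cast this
  have hd0 : (0 : ℝ) < d := by exact_mod_cast (by omega : 0 < d)
  obtain ⟨n, a, hside, hinf, x0, hx0, hpos⟩ := aux_height hd hPconv hdim hF
  have hfin : (P.extremePoints ℝ).Finite := V.finite_toSet.subset extremePoints_convexHull_subset
  have hextne : (P.extremePoints ℝ).Nonempty := hPc.extremePoints_nonempty ⟨u, hu⟩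
  have hinf1 : ∀ x ∈ P, infDist x ((affineSpan ℝ F : AffineSubspace ℝ (Pt d)) : Set (Pt d))
      = inner ℝ n (x - a) := by
    intro x hx
    have := hinf 1 one_pos x hx
    rwa [one_smul, one_smul, one_mul] at this
  set D := (fun v => infDist v ((affineSpan ℝ F : AffineSubspace ℝ (Pt d)) : Set (Pt d))) ''
    Set.extremePoints ℝ P with hD
  have hw : facetWidth P F = sSup D := rfl
  have hDmem : sSup D ∈ D := (hextne.image _).csSup_mem (hfin.image _)
  obtain ⟨z, hz, hzw⟩ := hDmem
  simp only at hzw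
  have hzP : z ∈ P := hz.1
  rw [hinf1 z hzP] at hzw
  set w := inner ℝ n (z - a) with hwdef
  have hub : ∀ x ∈ P, inner ℝ n (x - a) ≤ w := by
    have hsub : P ⊆ {x | inner ℝ n (x - a) ≤ w} := by
      rw [← closure_convexHull_extremePoints hPc hPconv]
      refine closure_minimal (convexHull_min ?_ ?_) ?_
      · intro v hv
        simp only [mem_ofPred_eq]
        rw [hzw, ← hinf1 v hv.1]
        exact le_csSup (hfin.image _).bddAbove (mem_image_of_mem _ hv)
      · intro x hx y hy s t hs ht hst
        simp only [mem_ofPred_eq, inner_sub_right, inner_add_right, inner_smul_right] at hx hy ⊢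
        have : t = 1 - s := by linarith
        subst this
        nlinarith
      · exact isClosed_le (by fun_prop) continuous_const
    exact fun x hx => hsub hx
  have hw0 : 0 < w := hpos.trans_le (hub x0 hx0)
  obtain ⟨W, hWV, hWe, hWd, g, hg, α, s, hα, hs, hαs, hgz⟩ := aux_cover hd V hdim z u hzP hu
  simp only at hdist
  rw [hw, ← hzw, hinf c hc0 u hu] at hdist
  have hsc : c * s ≤ 1 / ((d : ℝ) + 1) := by
    have hα' : α = 1 - s := by linarith
    have h1 : inner ℝ n (u - a) = α * inner ℝ n (g - a) + s * w := by
      have : u - a = α • (g - a) + s • (z - a) := by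
        rw [← hgz, hα']; module
      rw [this, inner_add_right, inner_smul_right, inner_smul_right]
    have h2 : 0 ≤ α * inner ℝ n (g - a) := mul_nonneg hα (hside g (hWe.subset hg))
    have h3 : c * (s * w) ≤ w / ((d : ℝ) + 1) := by
      refine le_trans ?_ hdist
      apply mul_le_mul_of_nonneg_left _ hc0.le
      linarith
    have h4 : (c * s) * w ≤ (1 / ((d : ℝ) + 1)) * w := by
      calc (c * s) * w = c * (s * w) := by ring
        _ ≤ _ := h3
        _ = _ := by ring
    exact le_of_mul_le_mul_right h4 hw0
  set T : Set ℝ := {r | ((c : ℝ) - 1 + r) • g + (1 - r) • z ∈ cnUnion P (c : ℝ)} with hT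
  have hTc : IsClosed T := (aux_cn_closed V (c : ℝ)).preimage
    (by fun_prop : Continuous fun r : ℝ => ((c : ℝ) - 1 + r) • g + (1 - r) • z)
  have hlt : (d : ℝ) / (d + 1) < 1 := by
    rw [div_lt_one (by positivity)]; linarith
  have hIoo : Icc ((d : ℝ) / (d + 1)) 1 ⊆ T := by
    rw [← closure_Ioo hlt.ne]
    refine closure_minimal ?_ hTc
    refine (Rat.denseRange_cast (𝕜 := ℝ)).open_subset_closure_inter isOpen_Ioo |>.trans ?_
    refine closure_minimal ?_ hTc
    rintro _ ⟨⟨h1, h2⟩, r, rfl⟩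
    have h1' : (d : ℚ) / (d + 1) ≤ r := by
      rw [← Rat.cast_le (K := ℝ)]
      push_cast
      exact h1.le
    have h2' : r ≤ 1 := by exact_mod_cast h2.le
    exact aux_main_s8 hd k lam hlam hyp V W hV hWV hWe hWd hedge c hc2 hck r h2' h1' z g hzP hg
  have hfinal : 1 - c * s ∈ T := by
    apply hIoo
    constructor
    · have : (d : ℝ) / (d + 1) = 1 - 1 / (d + 1) := by field_simp; ring
      linarith
    · have : 0 ≤ c * s := mul_nonneg hc0.le hs
      linarith
  have heq : (c : ℝ) • u = ((c : ℝ) - 1 + (1 - c * s)) • g + (1 - (1 - c * s)) • z := by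
    have hα' : α = 1 - s := by linarith
    rw [← hgz, hα']; module
  simp only
  rw [heq]
  exact hfinal
end
end

section
/- Let d be a positive integer, l ∈ ℚ with l ≥ 1, and let P ⊂ ℝ^d be a rational polytope of dimension d all of whose edges have lattice length at least l·d·(d+1). Assume 0 is a vertex of P, and set ε_F = width_F(P)/(l(d+1)) for each facet F of P. Then every point of P(0, ε̄) lies in some lattice parallelepiped contained in P; that is, the union of all lattice parallelepipeds inside P contains P(0, ε̄). -/
open Set Metric Pointwise

noncomputable section

lemma infDist_hyper {d : ℕ} (n : Pt d) (hn : n ≠ 0) (c : ℝ) (y : Pt d) :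
    infDist y {z : Pt d | inner ℝ n z = c} = |c - inner ℝ n y| / ‖n‖ := by
  have hn' : 0 < ‖n‖ := norm_pos_iff.2 hn
  have hz : y + ((c - inner ℝ n y) / ‖n‖ ^ 2) • n ∈ {z : Pt d | inner ℝ n z = c} := by
    simp only [mem_ofPred_eq, inner_add_right, inner_smul_right, real_inner_self_eq_norm_sq]
    field_simp
    ring
  apply le_antisymm
  · refine (infDist_le_dist_of_mem hz).trans (le_of_eq ?_)
    rw [dist_self_add_right, norm_smul, Real.norm_eq_abs, abs_div, abs_of_pos (by positivity : 0 < ‖n‖ ^ 2)]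
    field_simp
  · rw [le_infDist ⟨_, hz⟩]
    intro w hw
    rw [div_le_iff₀ hn']
    have : c - inner ℝ n y = inner ℝ n (w - y) := by
      rw [inner_sub_right]; rw [mem_ofPred_eq] at hw; rw [hw]
    rw [this, mul_comm, dist_comm, dist_eq_norm]
    exact abs_real_inner_le_norm n (w - y)

lemma facet_sep {d : ℕ} (hd : 0 < d) (V : Finset (Pt d)) (P : Set (Pt d))
    (hPV : P = convexHull ℝ (V : Set (Pt d))) (hdim : polyDim P = d) (x : Pt d) (hx : x ∉ P)
    (hne : P.Nonempty) :
    ∃ (n : Pt d) (c : ℝ), n ≠ 0 ∧ (∀ y ∈ P, inner ℝ n y ≤ c) ∧ c < inner ℝ n x ∧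
      IsFacetOf P {y ∈ P | inner ℝ n y = c} ∧
      ((affineSpan ℝ {y ∈ P | inner ℝ n y = c} : AffineSubspace ℝ (Pt d)) : Set (Pt d))
        = {z : Pt d | inner ℝ n z = c} := by
  have hconv : Convex ℝ P := hPV ▸ convex_convexHull ℝ _
  have hcomp : IsCompact P := hPV ▸ V.finite_toSet.isCompact_convexHull ℝ
  have hVP : ∀ v ∈ V, v ∈ P := fun v hv => hPV ▸ subset_convexHull ℝ _ hv
  have hspan : affineSpan ℝ P = ⊤ := by
    rw [AffineSubspace.affineSpan_eq_top_iff_vectorSpan_eq_top_of_nonempty ℝ (Pt d) (Pt d) hne]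
    apply Submodule.eq_top_of_finrank_eq
    unfold polyDim at hdim
    rw [hdim]; simp
  obtain ⟨o, ho⟩ := hconv.interior_nonempty_iff_affineSpan_eq_top.2 hspan
  obtain ⟨r, hr, hball⟩ := Metric.isOpen_iff.1 isOpen_interior o ho
  have hoP : o ∈ P := interior_subset ho
  -- halfspaces valid on V are valid on P
  have hull : ∀ (n : Pt d) (c : ℝ), (∀ v ∈ V, inner ℝ n v ≤ c) → ∀ y ∈ P, inner ℝ n y ≤ c := by
    intro n c h y hy
    rw [hPV] at hy
    have hc : Convex ℝ {z : Pt d | inner ℝ n z ≤ c} :=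
      convex_halfSpace_le (innerₛₗ ℝ n).isLinear c
    exact convexHull_min (fun v hv => h v hv) hc hy
  let Q : Set (Pt d) := {n | ∀ v ∈ V, inner ℝ n (v - o) ≤ 1}
  have hQP : ∀ n ∈ Q, ∀ y ∈ P, inner ℝ n (y - o) ≤ 1 := by
    intro n hn y hy
    have := hull n (1 + inner ℝ n o) (fun v hv => by
      have := hn v hv; rw [inner_sub_right] at this; linarith) y hy
    rw [inner_sub_right]; linarith
  have hQclosed : IsClosed Q := by
    have : Q = ⋂ v ∈ V, {n : Pt d | inner ℝ n (v - o) ≤ 1} := by ext; simp [Q]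
    rw [this]
    exact isClosed_biInter fun v _ => isClosed_le (by fun_prop) continuous_const
  have hQb : Q ⊆ closedBall 0 (2 / r) := by
    intro n hn
    rw [mem_closedBall_zero_iff]
    by_cases h0 : n = 0
    · rw [h0, norm_zero]; positivity
    have hn' : 0 < ‖n‖ := norm_pos_iff.2 h0
    have hy : o + (r / 2 / ‖n‖) • n ∈ P := by
      apply interior_subset; apply hball
      rw [mem_ball, dist_self_add_left, norm_smul, Real.norm_eq_abs, abs_of_pos (by positivity)]
      field_simp; linarith
    have := hQP n hn _ hy
    rw [add_sub_cancel_left, inner_smul_right, real_inner_self_eq_norm_sq] at this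
    rw [le_div_iff₀ hr]
    field_simp at this
    linarith
  have hQcomp : IsCompact Q := (isCompact_closedBall 0 (2 / r)).of_isClosed_subset hQclosed hQb
  -- separate x
  obtain ⟨n₀, hn₀, hn₀x⟩ : ∃ n ∈ Q, 1 < inner ℝ n (x - o) := by
    obtain ⟨f, u, hfu, hux⟩ := geometric_hahn_banach_closed_point hconv hcomp.isClosed hx
    have hfo := hfu o hoP
    have hpos : 0 < u - f o := by linarith
    refine ⟨(u - f o)⁻¹ • (InnerProductSpace.toDual ℝ (Pt d)).symm f, ?_, ?_⟩
    · intro v hv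
      rw [real_inner_smul_left, InnerProductSpace.toDual_symm_apply, map_sub, inv_mul_le_iff₀ hpos]
      linarith [hfu v (hVP v hv)]
    · rw [real_inner_smul_left, InnerProductSpace.toDual_symm_apply, map_sub, lt_inv_mul_iff₀ hpos]
      linarith
  let φ : StrongDual ℝ (Pt d) := innerSL ℝ (x - o)
  have hφ : ∀ y, φ y = inner ℝ y (x - o) := fun y => by
    simp only [φ, innerSL_apply_apply]; exact real_inner_comm _ _
  have hexp : IsExposed ℝ Q (φ.toExposed Q) := ContinuousLinearMap.toExposed.isExposed
  have hexpne : (φ.toExposed Q).Nonempty := by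
    obtain ⟨m, hm, hmax⟩ := hQcomp.exists_isMaxOn ⟨n₀, hn₀⟩ φ.continuous.continuousOn
    exact ⟨m, hm, fun y hy => hmax hy⟩
  obtain ⟨n, hn⟩ := (hexp.isCompact hQcomp).extremePoints_nonempty hexpne
  have hnx : 1 < inner ℝ n (x - o) := by
    have := hn.1.2 n₀ hn₀
    rw [hφ, hφ] at this
    linarith
  have hnext : n ∈ Q.extremePoints ℝ := hexp.isExtreme.extremePoints_subset_extremePoints hn
  have hnQ : n ∈ Q := hnext.1
  have hn0 : n ≠ 0 := by
    rintro rfl; rw [inner_zero_left] at hnx; linarith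
  let A : Set (Pt d) := {a | ∃ v ∈ V, a = v - o ∧ inner ℝ n (v - o) = 1}
  have hA : Submodule.span ℝ A = ⊤ := by
    rw [← Submodule.orthogonal_eq_bot_iff, Submodule.eq_bot_iff]
    intro m hm
    have hm' : ∀ a ∈ A, inner ℝ m a = 0 := fun a ha => by
      rw [real_inner_comm]
      exact (Submodule.mem_orthogonal _ _).1 hm a (Submodule.subset_span ha)
    have hev : ∀ᶠ δ : ℝ in nhds 0, ∀ v ∈ V, inner ℝ (n + δ • m) (v - o) ≤ 1 := by
      rw [Finset.eventually_all]
      intro v hv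
      by_cases h1 : inner ℝ n (v - o) = 1
      · have := hm' (v - o) ⟨v, hv, rfl, h1⟩
        refine Filter.Eventually.of_forall fun δ => ?_
        rw [inner_add_left, real_inner_smul_left, this, h1]; simp
      · have h2 : inner ℝ n (v - o) < 1 := lt_of_le_of_ne (hnQ v hv) h1
        have hc : Continuous fun δ : ℝ => inner ℝ (n + δ • m) (v - o) := by fun_prop
        have := hc.continuousAt.eventually_lt (x₀ := (0:ℝ)) continuousAt_const
          (by simpa using h2)
        exact this.mono fun δ h => h.le
    obtain ⟨ε, hε, hball⟩ := Metric.eventually_nhds_iff.1 hev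
    have h1 : n + (ε / 2) • m ∈ Q := hball (by simp [abs_of_pos hε]; linarith)
    have h2 : n + (-(ε / 2)) • m ∈ Q := hball (by simp [abs_of_pos hε]; linarith)
    have := hnext.2 h1 h2 ⟨1/2, 1/2, by norm_num, by norm_num, by norm_num, by module⟩
    have h3 : (ε / 2) • m = 0 := by simpa using this
    rcases smul_eq_zero.1 h3 with h | h
    · linarith
    · exact h
  set c : ℝ := 1 + inner ℝ n o with hc
  have hin : ∀ y, inner ℝ n (y - o) = 1 ↔ inner ℝ n y = c := fun y => by
    rw [inner_sub_right, hc]; constructor <;> intro h <;> linarith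
  set F : Set (Pt d) := {y ∈ P | inner ℝ n y = c} with hF
  have hle : ∀ y ∈ P, inner ℝ n y ≤ c := fun y hy => by
    have := hQP n hnQ y hy
    rw [inner_sub_right] at this; linarith
  have hAne : A.Nonempty := by
    by_contra h
    rw [Set.not_nonempty_iff_eq_empty] at h
    rw [h, Submodule.span_empty] at hA
    have := (Submodule.eq_bot_iff ⊤).1 hA.symm n trivial
    exact hn0 this
  obtain ⟨_, q, hqV, rfl, hq⟩ := hAne
  have hqF : q ∈ F := ⟨hVP q hqV, (hin q).1 hq⟩
  have key : ∀ y : Pt d, y - (inner ℝ n y : ℝ) • (q - o) ∈ vectorSpan ℝ F := by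
    let T : Pt d →ₗ[ℝ] Pt d := LinearMap.id - (innerₛₗ ℝ n).smulRight (q - o)
    have hT : ∀ y, T y = y - (inner ℝ n y : ℝ) • (q - o) := fun y => by simp [T]
    have : (⊤ : Submodule ℝ (Pt d)) ≤ (vectorSpan ℝ F).comap T := by
      rw [← hA, Submodule.span_le]
      rintro _ ⟨v, hv, rfl, h1⟩
      simp only [Submodule.comap_coe, mem_preimage, hT, h1, one_smul, SetLike.mem_coe]
      have h2 : v - o - (q - o) = v -ᵥ q := by simp
      rw [h2]
      exact vsub_mem_vectorSpan ℝ ⟨hVP v hv, (hin v).1 h1⟩ hqF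
    intro y
    rw [← hT]
    exact this (Submodule.mem_top (x := y))
  have hdir : vectorSpan ℝ F = (ℝ ∙ n)ᗮ := by
    apply le_antisymm
    · rw [vectorSpan_def, Submodule.span_le]
      rintro _ ⟨a, ha, b, hb, rfl⟩
      simp only [SetLike.mem_coe]
      rw [Submodule.mem_orthogonal_singleton_iff_inner_right]
      simp only [vsub_eq_sub]
      rw [inner_sub_right, ha.2, hb.2, sub_self]
    · intro y hy
      rw [Submodule.mem_orthogonal_singleton_iff_inner_right] at hy
      have := key y
      rwa [hy, zero_smul, sub_zero] at this
  refine ⟨n, c, hn0, hle, ?_, ⟨⟨?_, ?_, ?_⟩, ?_⟩, ?_⟩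
  · rw [inner_sub_right] at hnx; linarith
  · refine ⟨fun y hy => hy.1, ?_⟩
    rintro a ha b hb z ⟨hz, hzc⟩ ⟨s, t, hs, ht, hst, rfl⟩
    refine ⟨ha, le_antisymm (hle a ha) ?_⟩
    rw [inner_add_right, inner_smul_right, inner_smul_right] at hzc
    have h1 := hle b hb
    by_contra h
    push Not at h
    have e1 : s * inner ℝ n a < s * c := mul_lt_mul_of_pos_left h hs
    have e2 : t * inner ℝ n b ≤ t * c := mul_le_mul_of_nonneg_left h1 ht.le
    have e3 : s * c + t * c = c := by rw [← add_mul, hst, one_mul]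
    linarith
  · have : F = P ∩ {z : Pt d | inner ℝ n z = c} := rfl
    change Convex ℝ F
    rw [this]
    exact hconv.inter (convex_hyperplane (innerₛₗ ℝ n).isLinear c)
  · have : F = P ∩ {z : Pt d | inner ℝ n z = c} := rfl
    change IsClosed F
    rw [this]
    exact hcomp.isClosed.inter (isClosed_eq (by fun_prop) continuous_const)
  · rw [hdim]
    unfold polyDim
    rw [hdir]
    obtain ⟨k, rfl⟩ : ∃ k, d = k + 1 := ⟨d - 1, by omega⟩
    have hfact : Fact (Module.finrank ℝ (Pt (k+1)) = k + 1) := ⟨by simp⟩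
    rw [Submodule.finrank_orthogonal_span_singleton (_i := hfact) hn0]
  · ext z
    rw [SetLike.mem_coe, mem_ofPred_eq]
    have h1 : z ∈ affineSpan ℝ F ↔ z - q ∈ vectorSpan ℝ F := by
      rw [← direction_affineSpan, ← vsub_eq_sub,
        AffineSubspace.vsub_right_mem_direction_iff_mem (mem_affineSpan ℝ hqF)]
    rw [h1, hdir, Submodule.mem_orthogonal_singleton_iff_inner_right, inner_sub_right, hqF.2,
      sub_eq_zero]

lemma rat_dir {d : ℕ} (v : Pt d) (hv : IsRatPt v) (h0 : v ≠ 0) :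
    ∃ (u : Fin d → ℤ) (r : ℝ), 0 < r ∧ IsPrimitive u ∧ ∀ i, v i = r * (u i : ℝ) := by
  choose q hq using hv
  obtain ⟨i₀, hi₀⟩ : ∃ i, v i ≠ 0 := by
    by_contra h
    push Not at h
    exact h0 (by ext i; simpa using h i)
  let D : ℕ := ∏ i, (q i).den
  have hD : 0 < D := Finset.prod_pos fun i _ => (q i).pos
  have hz : ∀ i, ∃ z : ℤ, (D : ℚ) * q i = z := by
    intro i
    obtain ⟨e, he⟩ : (q i).den ∣ D := Finset.dvd_prod_of_mem _ (Finset.mem_univ i)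
    refine ⟨e * (q i).num, ?_⟩
    rw [he]; push_cast
    have := Rat.den_mul_eq_num (q i)
    linear_combination (e : ℚ) * this
  choose z hz using hz
  obtain ⟨u, hu, hu1⟩ := Finset.extract_gcd (s := Finset.univ) z ⟨i₀, Finset.mem_univ _⟩
  set g := Finset.univ.gcd z with hg
  have hg0 : 0 ≤ g := by
    have := Finset.normalize_gcd (s := Finset.univ) (f := z)
    rw [← hg] at this
    rw [← this]
    exact Int.nonneg_of_normalize_eq_self (normalize_idem _)
  have hDR : (0 : ℝ) < D := by exact_mod_cast hD
  have hvz : ∀ i, v i = (g / D : ℝ) * (u i : ℝ) := by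
    intro i
    have h1 : (D : ℝ) * v i = z i := by
      rw [hq i]; exact_mod_cast hz i
    have h2 : (z i : ℝ) = g * u i := by exact_mod_cast hu i (Finset.mem_univ i)
    field_simp
    linarith
  have hgne : g ≠ 0 := by
    intro h
    apply hi₀
    rw [hvz i₀, h]; simp
  have : (0 : ℝ) < g := by exact_mod_cast lt_of_le_of_ne hg0 hgne.symm
  exact ⟨u, g / D, by positivity, hu1, hvz⟩

lemma vertex_figure {d : ℕ} (V : Finset (Pt d)) (hVr : ∀ v ∈ V, IsRatPt v) (P : Set (Pt d))
    (hPV : P = convexHull ℝ (V : Set (Pt d))) (B : ℝ) (hedges : EdgeLengthsGE P B)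
    (hv : (0 : Pt d) ∈ Set.extremePoints ℝ P) :
    ∃ (f : StrongDual ℝ (Pt d)) (S : Set (Pt d)), (∀ k ∈ S, f k = 1) ∧
      (∀ k ∈ S, ∃ r : ℝ, 0 < r ∧ IsLatticePt (r • k) ∧ ∃ t : ℝ, 0 < t ∧ B ≤ t ∧ t • (r • k) ∈ P) ∧
      ∀ p ∈ P, p ≠ 0 → 0 < f p ∧ (f p)⁻¹ • p ∈ convexHull ℝ S := by
  classical
  have hconv : Convex ℝ P := hPV ▸ convex_convexHull ℝ _
  have hcomp : IsCompact P := hPV ▸ V.finite_toSet.isCompact_convexHull ℝ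
  have hVP : ∀ v ∈ V, v ∈ P := fun v hv => hPV ▸ subset_convexHull ℝ _ hv
  have h0V : (0 : Pt d) ∉ convexHull ℝ ((V.erase 0 : Finset (Pt d)) : Set (Pt d)) := by
    intro h
    have hc := (hconv.mem_extremePoints_iff_convex_sdiff.1 hv).2
    have : ((V.erase 0 : Finset (Pt d)) : Set (Pt d)) ⊆ P \ {0} := by
      intro v hv
      simp only [Finset.coe_erase, mem_sdiff, Finset.mem_coe, mem_singleton_iff] at hv
      exact ⟨hVP v hv.1, hv.2⟩
    exact (convexHull_min this hc h).2 rfl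
  obtain ⟨f, u, hu0, hu⟩ := geometric_hahn_banach_point_closed (convex_convexHull ℝ _)
    ((V.erase 0).finite_toSet.isCompact_convexHull ℝ).isClosed h0V
  rw [map_zero] at hu0
  have hfpos : ∀ v ∈ V, v ≠ 0 → 0 < f v := fun v hv h =>
    hu0.trans (hu v (subset_convexHull ℝ _ (by simp [h, hv])))
  let W : Finset (Pt d) := (V.erase 0).image fun v => (f v)⁻¹ • v
  let K : Set (Pt d) := convexHull ℝ (W : Set (Pt d))
  have hKconv : Convex ℝ K := convex_convexHull ℝ _
  have hKcomp : IsCompact K := W.finite_toSet.isCompact_convexHull ℝ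
  have hK1 : ∀ k ∈ K, f k = 1 := by
    have hc : Convex ℝ {z : Pt d | f z = 1} := convex_hyperplane f.toLinearMap.isLinear 1
    refine fun k hk => convexHull_min ?_ hc hk
    intro w hw
    simp only [W, Finset.coe_image, Set.mem_image, Finset.mem_coe, Finset.mem_erase] at hw
    obtain ⟨v, hv, rfl⟩ := hw
    have := hfpos v hv.2 hv.1
    simp [this.ne']
  -- normalisation of a positive combination
  have comb : ∀ (p q : Pt d) (a b : ℝ), 0 < f p → 0 < f q → 0 < a → 0 < b →
      0 < a * f p + b * f q ∧ (a * f p + b * f q)⁻¹ • (a • p + b • q) =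
      (a * f p / (a * f p + b * f q)) • ((f p)⁻¹ • p) +
        (b * f q / (a * f p + b * f q)) • ((f q)⁻¹ • q) := by
    intro p q a b hp hq ha hb
    have hD : 0 < a * f p + b * f q := by positivity
    refine ⟨hD, ?_⟩
    rw [smul_add, smul_smul, smul_smul, smul_smul, smul_smul]
    congr 2 <;> field_simp
  have hcone : ∀ p ∈ P, p ≠ 0 → 0 < f p ∧ (f p)⁻¹ • p ∈ K := by
    have hc : Convex ℝ {p : Pt d | p = 0 ∨ (0 < f p ∧ (f p)⁻¹ • p ∈ K)} := by
      rw [convex_iff_forall_pos]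
      have hs : ∀ (p : Pt d) (a : ℝ), 0 < a → (0 < f p ∧ (f p)⁻¹ • p ∈ K) →
          (0 < f (a • p) ∧ (f (a • p))⁻¹ • (a • p) ∈ K) := by
        rintro p a ha ⟨h1, h2⟩
        rw [map_smul, smul_eq_mul]
        refine ⟨by positivity, ?_⟩
        have : (a * f p)⁻¹ • a • p = (f p)⁻¹ • p := by
          rw [smul_smul]; congr 1; field_simp
        rwa [this]
      rintro p (rfl | hp) q (rfl | hq) a b ha hb hab
      · left; simp
      · right; simpa using hs q b hb hq
      · right; simpa using hs p a ha hp
      · right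
        obtain ⟨hD, he⟩ := comb p q a b hp.1 hq.1 ha hb
        have hf : f (a • p + b • q) = a * f p + b * f q := by simp
        rw [hf]
        refine ⟨hD, ?_⟩
        rw [he]
        have := hp.1
        have := hq.1
        exact hKconv hp.2 hq.2 (by positivity) (by positivity) (by field_simp)
    intro p hp h0
    rw [hPV] at hp
    have := convexHull_min (t := {p : Pt d | p = 0 ∨ (0 < f p ∧ (f p)⁻¹ • p ∈ K)}) ?_ hc hp
    · exact this.resolve_left h0
    · intro v hv
      by_cases h : v = 0
      · exact Or.inl h
      · refine Or.inr ⟨hfpos v hv h, subset_convexHull ℝ _ ?_⟩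
        simp only [W, Finset.coe_image, Set.mem_image]
        exact ⟨v, by simpa using ⟨hv, h⟩, rfl⟩
  let S : Set (Pt d) := K.extremePoints ℝ
  have hSW : S ⊆ W := extremePoints_convexHull_subset
  have hSfin : S.Finite := W.finite_toSet.subset hSW
  have hKS : convexHull ℝ S = K := by
    have := closure_convexHull_extremePoints hKcomp hKconv
    rwa [(hSfin.isCompact_convexHull ℝ).isClosed.closure_eq] at this
  refine ⟨f, S, fun k hk => hK1 k hk.1, ?_, by rw [hKS]; exact hcone⟩
  intro k hk
  have hkW := hSW hk
  simp only [W, Finset.coe_image, Set.mem_image, Finset.mem_coe, Finset.mem_erase] at hkW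
  obtain ⟨v, ⟨hv0, hvV⟩, hvk⟩ := hkW
  have hfv := hfpos v hvV hv0
  have hfk : f k = 1 := hK1 k hk.1
  have hk0 : k ≠ 0 := by rintro rfl; simp at hfk
  obtain ⟨u, r, hr, hu, hvu⟩ := rat_dir v (hVr v hvV) hv0
  obtain ⟨M, hM⟩ := hcomp.bddAbove_image f.continuous.continuousOn
  let T : Set ℝ := {s | 0 ≤ s ∧ s • k ∈ P}
  have hTcomp : IsCompact T := by
    refine (isCompact_Icc (a := 0) (b := M)).of_isClosed_subset ?_ ?_
    · exact isClosed_Ici.inter (hcomp.isClosed.preimage (by fun_prop : Continuous fun s : ℝ => s • k))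
    · rintro s ⟨h1, h2⟩
      refine ⟨h1, ?_⟩
      have := hM (Set.mem_image_of_mem f h2)
      simpa [hfk] using this
  have hvT : f v ∈ T := ⟨hfv.le, by rw [← hvk, smul_smul, mul_inv_cancel₀ hfv.ne', one_smul]; exact hVP v hvV⟩
  obtain ⟨s, hsT, hs⟩ := hTcomp.exists_isGreatest ⟨_, hvT⟩
  have hspos : 0 < s := hfv.trans_le (hs hvT)
  have hseg : ∀ σ : ℝ, 0 ≤ σ → σ • k ∈ P → σ • k ∈ segment ℝ 0 (s • k) := by
    intro σ h1 h2
    have h3 : σ ≤ s := hs ⟨h1, h2⟩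
    refine ⟨1 - σ / s, σ / s, ?_, by positivity, by ring, ?_⟩
    · rw [sub_nonneg, div_le_one hspos]; exact h3
    · rw [smul_zero, zero_add, smul_smul]; congr 1; field_simp
  have hedge : IsEdge P 0 (s • k) := by
    refine ⟨(smul_ne_zero hspos.ne' hk0).symm, hconv.segment_subset hv.1 hsT.2, ?_⟩
    rintro a ha b hb z hz ⟨α, β, hα, hβ, hαβ, rfl⟩
    by_cases ha0 : a = 0
    · rw [ha0]; exact left_mem_segment ℝ _ _
    obtain ⟨x, τ, hx, hτ, hxτ, hzeq⟩ := hz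
    rw [smul_zero, zero_add, smul_smul] at hzeq
    have hfz : τ * s = α * f a + β * f b := by
      have := congrArg f hzeq
      simpa [hfk] using this
    by_cases hb0 : b = 0
    · subst hb0
      have : a = (τ * s / α) • k := by
        rw [div_eq_inv_mul, mul_smul, hzeq, smul_zero, add_zero, smul_smul, inv_mul_cancel₀ hα.ne', one_smul]
      rw [this]
      exact hseg _ (by positivity) (this ▸ ha)
    · obtain ⟨ha1, ha2⟩ := hcone a ha ha0
      obtain ⟨hb1, hb2⟩ := hcone b hb hb0
      obtain ⟨hD, he⟩ := comb a b α β ha1 hb1 hα hβ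
      rw [← hzeq, ← hfz, smul_smul, inv_mul_cancel₀ (by rw [hfz]; exact hD.ne'), one_smul] at he
      rw [← hfz] at hD
      have := hk.2 ha2 hb2 ⟨_, _, by positivity, by positivity, by rw [← add_div, ← hfz]; exact div_self hD.ne', he.symm⟩
      have h2 : a = f a • k := by
        rw [← this, smul_smul, mul_inv_cancel₀ ha1.ne', one_smul]
      rw [h2]
      exact hseg _ ha1.le (h2 ▸ ha)
  have hki : ∀ i, k i = (f v)⁻¹ * (r * u i) := fun i => by
    rw [← hvk, ← hvu]; simp
  refine ⟨f v / r, by positivity, fun i => ⟨u i, ?_⟩, s * (f v)⁻¹ * r, by positivity, ?_, ?_⟩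
  · simp only [PiLp.smul_apply, smul_eq_mul]
    rw [hki i]
    field_simp
  · refine hedges 0 (s • k) hedge u _ (by positivity) hu fun i => ?_
    simp only [PiLp.smul_apply, smul_eq_mul, PiLp.zero_apply]
    rw [hki i]; ring
  · rw [smul_smul]
    have : s * (f v)⁻¹ * r * (f v / r) = s := by field_simp
    rw [this]; exact hsT.2

lemma edge_basis {d : ℕ} (V : Finset (Pt d)) (hVr : ∀ v ∈ V, IsRatPt v) (P : Set (Pt d))
    (hPV : P = convexHull ℝ (V : Set (Pt d))) (hdim : polyDim P = d)
    (B : ℝ) (hedges : EdgeLengthsGE P B)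
    (hv : (0 : Pt d) ∈ Set.extremePoints ℝ P) (p : Pt d) (hp : p ∈ P) :
    ∃ (w : Fin d → Pt d) (a t : Fin d → ℝ), LinearIndependent ℝ w ∧ (∀ i, IsLatticePt (w i)) ∧
      (∀ i, 0 ≤ a i) ∧ (∀ i, 0 < t i) ∧ (∀ i, B ≤ t i) ∧ (∀ i, t i • w i ∈ P) ∧
      p = ∑ i, a i • w i := by
  classical
  obtain ⟨f, S, hS1, hSE, hcone⟩ := vertex_figure V hVr P hPV B hedges hv
  obtain ⟨T, c, hTS, hTli, hc0, hpc⟩ : ∃ (T : Finset (Pt d)) (c : Pt d → ℝ), (T : Set (Pt d)) ⊆ S ∧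
      LinearIndepOn ℝ id (T : Set (Pt d)) ∧ (∀ k ∈ T, 0 ≤ c k) ∧ p = ∑ k ∈ T, c k • k := by
    by_cases hp0 : p = 0
    · exact ⟨∅, 0, by simp, by simp, by simp, by simp [hp0]⟩
    obtain ⟨hfp, hmem⟩ := hcone p hp hp0
    rw [convexHull_eq_union] at hmem
    simp only [Set.mem_iUnion, exists_prop] at hmem
    obtain ⟨T, hTS, hTa, hT⟩ := hmem
    rw [Finset.mem_convexHull'] at hT
    obtain ⟨w, hw0, hw1, hw⟩ := hT
    refine ⟨T, fun k => f p * w k, hTS, ?_, fun k hk => mul_nonneg hfp.le (hw0 k hk), ?_⟩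
    · rw [linearIndepOn_finset_iff]
      intro g hg
      have hsum : ∑ k ∈ T, g k = 0 := by
        have := congrArg f hg
        rw [map_sum, map_zero] at this
        rw [← this]
        refine Finset.sum_congr rfl fun k hk => ?_
        simp [hS1 k (hTS hk)]
      have h := affineIndependent_iff.1 hTa Finset.univ (fun k => g k)
        (by rw [← hsum]; exact Finset.sum_coe_sort T g)
        (by rw [← hg]; exact Finset.sum_coe_sort T (fun k => g k • id k))
      intro k hk
      exact h ⟨k, hk⟩ (Finset.mem_univ _)
    · simp only [mul_smul]
      rw [← Finset.smul_sum, hw, smul_smul, mul_inv_cancel₀ hfp.ne', one_smul]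
  have hspan : Submodule.span ℝ S = ⊤ := by
    have h1 : P ⊆ Submodule.span ℝ S := by
      intro q hq
      by_cases hq0 : q = 0
      · rw [hq0]; exact zero_mem _
      obtain ⟨hfq, hmem⟩ := hcone q hq hq0
      have h2 : convexHull ℝ S ⊆ Submodule.span ℝ S :=
        convexHull_min Submodule.subset_span (Submodule.convex _)
      have := Submodule.smul_mem _ (f q) (h2 hmem)
      rwa [smul_smul, mul_inv_cancel₀ hfq.ne', one_smul] at this
    have h2 : vectorSpan ℝ P = ⊤ := by
      apply Submodule.eq_top_of_finrank_eq
      unfold polyDim at hdim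
      rw [hdim]; simp
    rw [eq_top_iff, ← h2, vectorSpan_def, Submodule.span_le]
    rintro _ ⟨x, hx, y, hy, rfl⟩
    exact sub_mem (h1 hx) (h1 hy)
  obtain ⟨b, hbS, hTb, hSb, hbli⟩ := exists_linearIndepOn_id_extension hTli hTS
  have hbtop : Submodule.span ℝ b = ⊤ := by
    rw [eq_top_iff, ← hspan, Submodule.span_le]; exact hSb
  have hbli' : LinearIndependent ℝ ((↑) : b → Pt d) := hbli
  let bas : Module.Basis b ℝ (Pt d) := Module.Basis.mk hbli' (by simp [hbtop])
  have : Fintype b := FiniteDimensional.fintypeBasisIndex bas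
  have hcard : Fintype.card b = d := by
    rw [← Module.finrank_eq_card_basis bas]; simp
  let e : Fin d ≃ b := (Fintype.equivFinOfCardEq hcard).symm
  choose! r hr hlat t ht hBt htP using hSE
  have heS : ∀ i, (e i : Pt d) ∈ S := fun i => hbS (e i).2
  let c' : Pt d → ℝ := fun k => if k ∈ T then c k else 0
  have hc' : ∀ k, 0 ≤ c' k := fun k => by
    simp only [c']; split_ifs with h
    · exact hc0 k h
    · exact le_rfl
  refine ⟨fun i => r (e i) • (e i : Pt d), fun i => c' (e i) / r (e i), fun i => t (e i), ?_,
    fun i => hlat _ (heS i), fun i => div_nonneg (hc' _) (hr _ (heS i)).le, fun i => ht _ (heS i),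
    fun i => hBt _ (heS i), fun i => htP _ (heS i), ?_⟩
  · have h1 : LinearIndependent ℝ fun i => (e i : Pt d) := hbli'.comp e e.injective
    exact h1.units_smul (fun i => Units.mk0 (r (e i)) (hr _ (heS i)).ne')
  · have h1 : ∀ i, (c' (e i) / r (e i)) • (r (e i) • (e i : Pt d)) = c' (e i) • (e i : Pt d) := by
      intro i
      rw [smul_smul, div_mul_cancel₀ _ (hr _ (heS i)).ne']
    simp only [h1]
    rw [e.sum_comp (fun k : b => c' k • (k : Pt d))]
    rw [hpc]
    have h2 : ∑ k : b, c' k • (k : Pt d) = ∑ k ∈ b.toFinset, c' k • k := by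
      rw [← Finset.sum_coe_sort b.toFinset]
      exact Fintype.sum_equiv (Equiv.subtypeEquivRight (by simp)) _ _ (fun _ => rfl)
    rw [h2]
    have hTb' : T ⊆ b.toFinset := fun k hk => by simpa using hTb hk
    rw [← Finset.sum_subset hTb' (fun k _ hk => by simp [c', hk])]
    exact Finset.sum_congr rfl fun k hk => by simp [c', hk]

/-- Corollary 4.4. If `0` is a vertex of a rational `d`-polytope `P` with
edges of lattice length at least `l·d·(d+1)`, then the union of all lattice parallelepipeds
inside `P` contains `P(0, ε̄)`, where `ε_F = width_F(P)/(l(d+1))`. -/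
theorem statement11 (d : ℕ) (hd : 0 < d) (l : ℚ) (hl : 1 ≤ l)
    (P : Set (Pt d)) (hP : IsRationalPolytope P) (hdim : polyDim P = d)
    (hedges : EdgeLengthsGE P ((l : ℝ) * (d : ℝ) * ((d : ℝ) + 1)))
    (hv : (0 : Pt d) ∈ Set.extremePoints ℝ P) :
    ∀ p ∈ closure (P \ ⋃ F ∈ {F | IsFacetOf P F ∧ (0 : Pt d) ∉ F},
        layer P F (facetWidth P F / ((l : ℝ) * ((d : ℝ) + 1)))),
      ∃ L, IsLatticeParallelepiped L ∧ p ∈ L ∧ L ⊆ P := by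
  classical
  intro p hp
  obtain ⟨V, hVr, hPV⟩ := hP
  have hconv : Convex ℝ P := hPV ▸ convex_convexHull ℝ _
  have hcomp : IsCompact P := hPV ▸ V.finite_toSet.isCompact_convexHull ℝ
  have hpP : p ∈ P := closure_minimal Set.sdiff_subset hcomp.isClosed hp
  obtain ⟨w, a, t, hli, hlat, ha, ht, hBt, htP, hpa⟩ :=
    edge_basis V hVr P hPV hdim _ hedges hv p hpP
  refine ⟨Parallelepiped (∑ i, (⌊a i⌋ : ℝ) • w i) w, ⟨_, w, ?_, hlat, hli, rfl⟩, ?_, ?_⟩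
  · choose z hz using hlat
    intro j
    refine ⟨∑ i, ⌊a i⌋ * z i j, ?_⟩
    simp [hz]
  · refine ⟨fun i => Int.fract (a i), fun i => ⟨Int.fract_nonneg _, (Int.fract_lt_one _).le⟩, ?_⟩
    rw [← Finset.sum_add_distrib, hpa]
    refine Finset.sum_congr rfl fun i _ => ?_
    rw [← add_smul, Int.floor_add_fract]
  rintro x ⟨lam, hlam, hx⟩
  rw [← Finset.sum_add_distrib] at hx
  simp only [← add_smul] at hx
  by_contra hxP
  obtain ⟨n, c, hn0, hle, hcx, hfacet, haff⟩ := facet_sep hd V P hPV hdim x hxP ⟨0, hv.1⟩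
  set F : Set (Pt d) := {y ∈ P | inner ℝ n y = c} with hF
  have hn : 0 < ‖n‖ := norm_pos_iff.2 hn0
  have hdist : ∀ y ∈ P, infDist y ((affineSpan ℝ F : AffineSubspace ℝ (Pt d)) : Set (Pt d))
      = (c - inner ℝ n y) / ‖n‖ := fun y hy => by
    rw [haff, infDist_hyper n hn0, abs_of_nonneg (sub_nonneg.2 (hle y hy))]
  have hc0 : 0 ≤ c := by simpa using hle 0 hv.1
  have hb0 : ∀ i, 0 ≤ (⌊a i⌋ : ℝ) + lam i := fun i => by
    have : (0 : ℝ) ≤ ⌊a i⌋ := by exact_mod_cast Int.floor_nonneg.2 (ha i)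
    linarith [(hlam i).1]
  have hxin : inner ℝ n x = ∑ i, ((⌊a i⌋ : ℝ) + lam i) * inner ℝ n (w i) := by
    rw [hx, inner_sum]; simp only [inner_smul_right]
  have hpin : inner ℝ n p = ∑ i, a i * inner ℝ n (w i) := by
    rw [hpa, inner_sum]; simp only [inner_smul_right]
  have htw : ∀ i, t i * inner ℝ n (w i) ≤ c := fun i => by
    have := hle _ (htP i)
    rwa [inner_smul_right] at this
  have hcne : c ≠ 0 := by
    intro h
    have : inner ℝ n x ≤ 0 := by
      rw [hxin]
      refine Finset.sum_nonpos fun i _ => mul_nonpos_of_nonneg_of_nonpos (hb0 i) ?_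
      have h1 := htw i
      rw [h] at h1
      exact nonpos_of_mul_nonpos_right h1 (ht i)
    linarith
  have h0F : (0 : Pt d) ∉ F := fun h => hcne (by have := h.2; rw [inner_zero_right] at this; exact this.symm)
  set W := facetWidth P F with hW
  set N : ℝ := (l : ℝ) * ((d : ℝ) + 1) with hN
  have hlR : (1 : ℝ) ≤ l := by exact_mod_cast hl
  have hdR : (0 : ℝ) < d := by exact_mod_cast hd
  have hNpos : 0 < N := by positivity
  have hext : P.extremePoints ℝ ⊆ V := by
    rw [hPV]; exact extremePoints_convexHull_subset
  have hwid : ∀ y ∈ P, c - inner ℝ n y ≤ W * ‖n‖ := by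
    have hE : P.extremePoints ℝ ⊆ {y : Pt d | c - inner ℝ n y ≤ W * ‖n‖} := by
      intro y hy
      have : infDist y ((affineSpan ℝ F : AffineSubspace ℝ (Pt d)) : Set (Pt d)) ≤ W :=
        le_csSup ((V.finite_toSet.subset hext).image _).bddAbove (Set.mem_image_of_mem _ hy)
      rw [hdist y hy.1, div_le_iff₀ hn] at this
      exact this
    have hcl : IsClosed {y : Pt d | c - inner ℝ n y ≤ W * ‖n‖} :=
      isClosed_le (by fun_prop) continuous_const
    have hcv : Convex ℝ {y : Pt d | c - inner ℝ n y ≤ W * ‖n‖} := by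
      have : {y : Pt d | c - inner ℝ n y ≤ W * ‖n‖} = {y : Pt d | c - W * ‖n‖ ≤ inner ℝ n y} := by
        ext y; constructor <;> intro h <;> simp only [mem_ofPred_eq] at h ⊢ <;> linarith
      rw [this]
      exact convex_halfSpace_ge (innerₛₗ ℝ n).isLinear _
    intro y hy
    rw [← closure_convexHull_extremePoints hcomp hconv] at hy
    exact closure_minimal (convexHull_min hE hcv) hcl hy
  -- p is far from F
  have hpfar : W / N * ‖n‖ ≤ c - inner ℝ n p := by
    have hcl : IsClosed {y : Pt d | W / N * ‖n‖ ≤ c - inner ℝ n y} :=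
      isClosed_le continuous_const (by fun_prop)
    refine closure_minimal ?_ hcl hp
    rintro y ⟨hyP, hy⟩
    have h1 : y ∉ layer P F (W / N) := fun h => hy (Set.mem_biUnion (x := F) ⟨hfacet, h0F⟩ h)
    have h2 : ¬ (c - inner ℝ n y) / ‖n‖ ≤ W / N := fun h => h1 ⟨hyP, by rw [hdist y hyP]; exact h⟩
    push Not at h2
    rw [lt_div_iff₀ hn] at h2
    exact h2.le
  have hW0 : 0 ≤ W * ‖n‖ := by
    have := hwid 0 hv.1
    rw [inner_zero_right] at this; linarith
  have hbound : ∀ i, |inner ℝ n (w i)| ≤ W * ‖n‖ / (N * d) := by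
    intro i
    have h1 : |t i * inner ℝ n (w i)| ≤ W * ‖n‖ := by
      rw [abs_le]
      have e1 := htw i
      have e2 := hwid 0 hv.1
      have e3 := hwid _ (htP i)
      rw [inner_smul_right] at e3
      rw [inner_zero_right] at e2
      constructor <;> linarith
    rw [abs_mul, abs_of_pos (ht i)] at h1
    rw [le_div_iff₀ (by positivity)]
    have h2 : N * d ≤ t i := by
      have := hBt i
      rw [hN]; linarith
    calc |inner ℝ n (w i)| * (N * d) ≤ |inner ℝ n (w i)| * t i :=
          mul_le_mul_of_nonneg_left h2 (abs_nonneg _)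
      _ ≤ W * ‖n‖ := by linarith
  have hdiff : inner ℝ n x - inner ℝ n p ≤ W / N * ‖n‖ := by
    rw [hxin, hpin, ← Finset.sum_sub_distrib]
    calc ∑ i, (((⌊a i⌋ : ℝ) + lam i) * inner ℝ n (w i) - a i * inner ℝ n (w i))
        ≤ ∑ _i : Fin d, W * ‖n‖ / (N * d) := by
          refine Finset.sum_le_sum fun i _ => ?_
          rw [← sub_mul]
          refine (le_abs_self _).trans ?_
          rw [abs_mul]
          have h1 : |(⌊a i⌋ : ℝ) + lam i - a i| ≤ 1 := by
            rw [abs_le]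
            have e1 := Int.floor_le (a i)
            have e2 := Int.lt_floor_add_one (a i)
            have e3 := (hlam i).1
            have e4 := (hlam i).2
            constructor <;> linarith
          calc _ ≤ 1 * |inner ℝ n (w i)| := mul_le_mul_of_nonneg_right h1 (abs_nonneg _)
            _ ≤ _ := by rw [one_mul]; exact hbound i
      _ = W / N * ‖n‖ := by
          rw [Finset.sum_const, Finset.card_univ, Fintype.card_fin, nsmul_eq_mul]
          field_simp
  linarith
end
end
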